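/- arXiv:2309.02747 — 2 statements merged into one kernel-verified Lean document; each statement's English description precedes it below -/
import Mathlib

section
/- The language L = { a^n b^n : n ≥ 1 } is accepted by some reversible deterministic two-party Watson-Crick system. -/
namespace WK

/-- Tape symbols: input symbols plus the two endmarkers.
`Sum.inr false` is the left endmarker, `Sum.inr true` the right endmarker. -/
abbrev TSym (α : Type) : Type := α ⊕ Bool

/-- The tape for input `w`: left endmarker, the symbols of `w`, right endmarker. -/
def tape {α : Type} (w : List α) (k : ℕ) : TSym α :=
  ((Sum.inr false :: w.map Sum.inl) ++ [Sum.inr true]).getD k (Sum.inr true)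

/-- A deterministic two-party Watson-Crick system: two finite automata (the upper
component `1` and the lower component `2`) with a finite set `M` of messages,
partial transition functions `δᵢ` (depending on state, scanned symbol and received
message, `none` = no message) and broadcast functions `μᵢ`. -/
structure DPWK (α : Type) where
  M : Type
  Q1 : Type
  Q2 : Type
  fM : Fintype M
  fQ1 : Fintype Q1
  fQ2 : Fintype Q2
  δ1 : Q1 → TSym α → Option M → Option (Q1 × Bool)
  δ2 : Q2 → TSym α → Option M → Option (Q2 × Bool)
  μ1 : Q1 → TSym α → Option M
  μ2 : Q2 → TSym α → Option M
  q01 : Q1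
  q02 : Q2
  F1 : Set Q1
  F2 : Set Q2

/-- A configuration: states and head positions of the two components. -/
structure Config {α : Type} (A : DPWK α) where
  p : A.Q1
  i : ℕ
  q : A.Q2
  j : ℕ

/-- One synchronous (forward) computation step: each component reads its symbol,
receives the message broadcast by the other component, changes its state and
optionally moves (the upper head to the right, the lower head to the left). -/
def Step {α : Type} (A : DPWK α) (w : List α) (c c' : Config A) : Prop :=
  ∃ d1 d2 : Bool,
    A.δ1 c.p (tape w c.i) (A.μ2 c.q (tape w c.j)) = some (c'.p, d1) ∧
    A.δ2 c.q (tape w c.j) (A.μ1 c.p (tape w c.i)) = some (c'.q, d2) ∧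
    c'.i = c.i + (cond d1 1 0) ∧ c.j = c'.j + (cond d2 1 0)

/-- The initial configuration on input `w`: the upper component on the left
endmarker, the lower component on the right endmarker. -/
def initConf {α : Type} (A : DPWK α) (w : List α) : Config A :=
  ⟨A.q01, 0, A.q02, w.length + 1⟩

/-- The system halts in `c` if no successor configuration exists. -/
def Halted {α : Type} (A : DPWK α) (w : List α) (c : Config A) : Prop :=
  ¬ ∃ c', Step A w c c'

/-- A configuration is accepting if at least one component is in an accepting state. -/
def AccConf {α : Type} (A : DPWK α) (c : Config A) : Prop :=
  c.p ∈ A.F1 ∨ c.q ∈ A.F2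

/-- `cs` is an accepting computation of `A` on `w`: it starts in the initial
configuration, follows the step relation, and ends in a halting configuration
with at least one component in an accepting state. -/
def AccComp {α : Type} (A : DPWK α) (w : List α) (cs : List (Config A)) : Prop :=
  cs.head? = some (initConf A w) ∧ List.Chain' (Step A w) cs ∧
    ∃ c, cs.getLast? = some c ∧ Halted A w c ∧ AccConf A c

def Accepts {α : Type} (A : DPWK α) (w : List α) : Prop := ∃ cs, AccComp A w cs

/-- The language accepted by `A`. -/
def lang {α : Type} (A : DPWK α) : Set (List α) := { w | Accepts A w }

/-- One backward computation step, induced by reverse transition functions `δ'ᵢ` and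
reverse broadcast functions `μ'ᵢ`: the heads first move to their predecessor
positions (the upper head left, the lower head right) and then read the symbols there. -/
def BackStep {α : Type} (A : DPWK α)
    (δ'1 : A.Q1 → TSym α → Option A.M → Option (A.Q1 × Bool))
    (δ'2 : A.Q2 → TSym α → Option A.M → Option (A.Q2 × Bool))
    (μ'1 : A.Q1 → TSym α → Option A.M)
    (μ'2 : A.Q2 → TSym α → Option A.M)
    (w : List α) (c' c : Config A) : Prop :=
  ∃ d1 d2 : Bool,
    δ'1 c'.p (tape w c.i) (μ'2 c'.q (tape w c.j)) = some (c.p, d1) ∧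
    δ'2 c'.q (tape w c.j) (μ'1 c'.p (tape w c.i)) = some (c.q, d2) ∧
    c'.i = c.i + (cond d1 1 0) ∧ c.j = c'.j + (cond d2 1 0)

/-- A witness of reversibility: reverse transition and broadcast functions whose
induced backward step relation is exactly the inverse of the forward step relation,
so every configuration has at most one predecessor, computable by such a system. -/
structure RevWitness {α : Type} (A : DPWK α) where
  δ'1 : A.Q1 → TSym α → Option A.M → Option (A.Q1 × Bool)
  δ'2 : A.Q2 → TSym α → Option A.M → Option (A.Q2 × Bool)
  μ'1 : A.Q1 → TSym α → Option A.M
  μ'2 : A.Q2 → TSym α → Option A.M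
  inverse : ∀ (w : List α) (c c' : Config A),
    BackStep A δ'1 δ'2 μ'1 μ'2 w c' c ↔ Step A w c c'

/-- A reversible deterministic two-party Watson-Crick system (REV-PWK). -/
def Reversible {α : Type} (A : DPWK α) : Prop := Nonempty (RevWitness A)

/-- Number of messages (`0`, `1` or `2`) broadcast in one step from configuration `c`,
with respect to broadcast functions `μ1`, `μ2`. -/
def stepMsgs {α : Type} (A : DPWK α)
    (μ1 : A.Q1 → TSym α → Option A.M) (μ2 : A.Q2 → TSym α → Option A.M)
    (w : List α) (c : Config A) : ℕ :=
  ((μ1 c.p (tape w c.i)).elim 0 fun _ => 1) + ((μ2 c.q (tape w c.j)).elim 0 fun _ => 1)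

/-- Total number of messages sent during the computation `cs` (no messages are
sent from the final, halting configuration). -/
def commCount {α : Type} (A : DPWK α)
    (μ1 : A.Q1 → TSym α → Option A.M) (μ2 : A.Q2 → TSym α → Option A.M)
    (w : List α) (cs : List (Config A)) : ℕ :=
  (cs.dropLast.map (stepMsgs A μ1 μ2 w)).sum

/-- `A` is a reversible system that is communication bounded by `f`: it is reversible
and every word of its language is accepted by a computation in which the number of
messages sent in the forward computation and in the reverse computation are each at
most `f` of the input length. -/
def RevCommBounded {α : Type} (A : DPWK α) (f : ℕ → ℕ) : Prop :=
  ∃ Wit : RevWitness A, ∀ w ∈ lang A, ∃ cs, AccComp A w cs ∧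
    commCount A A.μ1 A.μ2 w cs ≤ f w.length ∧
    commCount A Wit.μ'1 Wit.μ'2 w cs.reverse ≤ f w.length

/-- `A` (not necessarily reversible) is communication bounded by `f`. -/
def CommBounded {α : Type} (A : DPWK α) (f : ℕ → ℕ) : Prop :=
  ∀ w ∈ lang A, ∃ cs, AccComp A w cs ∧ commCount A A.μ1 A.μ2 w cs ≤ f w.length

/-- The family of languages accepted by reversible deterministic two-party
Watson-Crick systems over the alphabet `α`. -/
def RevPWKLangs (α : Type) : Set (Set (List α)) :=
  { L | ∃ A : DPWK α, Reversible A ∧ lang A = L }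

/-- Languages accepted by REV-PWKs with `O(f)` communication. -/
def RevPWKLangsO (α : Type) (f : ℕ → ℕ) : Set (Set (List α)) :=
  { L | ∃ (A : DPWK α) (C : ℕ),
      RevCommBounded A (fun n => C * f n + C) ∧ lang A = L }

/-- Languages accepted by (possibly irreversible) DPWKs with `O(f)` communication. -/
def PWKLangsO (α : Type) (f : ℕ → ℕ) : Set (Set (List α)) :=
  { L | ∃ (A : DPWK α) (C : ℕ),
      CommBounded A (fun n => C * f n + C) ∧ lang A = L }

end WK

namespace WK

/-- Forward transition of the upper component, given its symbol and the lower one's symbol. -/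
def fwd : Fin 4 → TSym Bool → TSym Bool → Option (Fin 4)
  | 0, .inr false, .inr true => some 1
  | 1, .inl false, .inr true => some 1
  | 1, .inl false, .inl true => some 1
  | 1, .inl true, .inl true => some 2
  | 2, .inl true, .inl false => some 2
  | 2, .inr true, .inl false => some 3
  | _, _, _ => none

/-- Backward transition of the upper component. -/
def bwd : Fin 4 → TSym Bool → TSym Bool → Option (Fin 4)
  | 1, .inr false, .inr true => some 0
  | 1, .inl false, .inr true => some 1
  | 1, .inl false, .inl true => some 1
  | 2, .inl true, .inl true => some 1
  | 2, .inl true, .inl false => some 2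
  | 3, .inr true, .inl false => some 2
  | _, _, _ => none

theorem fwd_bwd : ∀ (p p' : Fin 4) (s t : TSym Bool),
    bwd p' s t = some p ↔ fwd p s t = some p' := by decide

/-- The upper component moves unless it is on the right endmarker. -/
def mv1 : TSym Bool → Bool
  | .inr true => false
  | _ => true

/-- The lower component moves unless the upper one is on the left endmarker. -/
def mv2 : TSym Bool → Bool
  | .inr false => false
  | _ => true

/-- The system: both components broadcast their scanned symbol. -/
def sys : DPWK Bool where
  M := TSym Bool
  Q1 := Fin 4
  Q2 := Unit
  fM := inferInstance
  fQ1 := inferInstance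
  fQ2 := inferInstance
  δ1 p s m := m.bind fun t => (fwd p s t).map fun p' => (p', mv1 s)
  δ2 _ _ m := m.map fun s => ((), mv2 s)
  μ1 _ s := some s
  μ2 _ t := some t
  q01 := (0 : Fin 4)
  q02 := ()
  F1 := {(3 : Fin 4)}
  F2 := ∅

/-- Configurations of `sys`. -/
def cf (p : Fin 4) (i j : ℕ) : Config sys := ⟨p, i, (), j⟩

theorem step_iff (w : List Bool) (p p' : Fin 4) (i j i' j' : ℕ) :
    Step sys w (cf p i j) (cf p' i' j') ↔
      fwd p (tape w i) (tape w j) = some p' ∧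
      i' = i + cond (mv1 (tape w i)) 1 0 ∧ j = j' + cond (mv2 (tape w i)) 1 0 := by
  simp only [Step, sys, cf]
  constructor
  · rintro ⟨d1, d2, h1, h2, h3, h4⟩
    simp at h1 h2
    obtain ⟨h1, rfl⟩ := h1
    subst h2
    exact ⟨h1, h3, h4⟩
  · rintro ⟨h1, h3, h4⟩
    exact ⟨_, _, by simp [h1], rfl, h3, h4⟩

theorem back_aux (p p' : Fin 4) (q q' : Unit) (i j i' j' : ℕ) (s t : TSym Bool)
    (h : bwd p' s t = some p ↔ fwd p s t = some p') :
    (∃ d1 d2 : Bool,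
      ((some t).bind fun t => (bwd p' s t).map fun p' => (p', mv1 s)) = some (p, d1) ∧
      ((some s).map fun s => ((), mv2 s)) = some (q, d2) ∧
      i' = i + cond d1 1 0 ∧ j = j' + cond d2 1 0) ↔
    fwd p s t = some p' ∧ i' = i + cond (mv1 s) 1 0 ∧ j = j' + cond (mv2 s) 1 0 := by
  rw [← h]
  constructor
  · rintro ⟨d1, d2, h1, h2, h3, h4⟩
    simp at h1 h2
    obtain ⟨h1, rfl⟩ := h1
    subst h2
    exact ⟨h1, h3, h4⟩
  · rintro ⟨h1, h3, h4⟩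
    exact ⟨_, _, by simp [h1], rfl, h3, h4⟩

theorem sys_rev : Reversible sys := by
  refine ⟨⟨fun p s m => m.bind fun t => (bwd p s t).map fun p' => (p', mv1 s),
    fun _ _ m => m.map fun s => ((), mv2 s), fun _ s => some s, fun _ t => some t, ?_⟩⟩
  rintro w ⟨p, i, q, j⟩ ⟨p', i', q', j'⟩
  refine Iff.trans ?_ (step_iff w p p' i j i' j').symm
  have := fwd_bwd p p' (tape w i) (tape w j)
  exact back_aux p p' q q' i j i' j' (tape w i) (tape w j) this

theorem tape_zero (w : List Bool) : tape w 0 = Sum.inr false := rfl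

theorem tape_succ (w : List Bool) (x : ℕ) (h : x < w.length) :
    tape w (x + 1) = Sum.inl w[x] := by
  simp [tape, List.getD, List.getElem?_append, h]

theorem tape_last (w : List Bool) (x : ℕ) (h : w.length + 1 ≤ x) :
    tape w x = Sum.inr true := by
  obtain ⟨y, rfl⟩ := Nat.exists_eq_add_of_le' h
  simp only [tape, List.getD]
  rw [List.getElem?_append_right (by simp)]
  cases y with
  | zero => simp
  | succ y => rw [List.getElem?_eq_none (by simp)]; rfl

theorem tape_inr_true {w : List Bool} {x : ℕ} (h : tape w x = Sum.inr true) :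
    w.length + 1 ≤ x := by
  by_contra hx
  rcases x with _ | x
  · simp [tape_zero] at h
  · rw [tape_succ w x (by omega)] at h; simp at h

theorem tape_inl {w : List Bool} {x : ℕ} {b : Bool} (h : tape w x = Sum.inl b) :
    1 ≤ x ∧ x ≤ w.length := by
  constructor
  · rcases x with _ | x
    · simp [tape_zero] at h
    · omega
  · by_contra hx
    rw [tape_last w x (by omega)] at h; simp at h

/-- The invariant. -/
def Inv (w : List Bool) (p : Fin 4) (i j : ℕ) : Prop :=
  (p = 0 ∧ i = 0 ∧ j = w.length + 1) ∨
  (p = 1 ∧ 1 ≤ i ∧ i + j = w.length + 2 ∧ ∀ x, 1 ≤ x → x < i → tape w x = Sum.inl false) ∨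
  (p = 2 ∧ i + j = w.length + 2 ∧ ∃ k, 1 ≤ k ∧ k + 2 ≤ i ∧
    (∀ x, 1 ≤ x → x ≤ k → tape w x = Sum.inl false) ∧
    (∀ x, k < x → x < i → tape w x = Sum.inl true) ∧
    (∀ y, y + k = w.length + 1 → tape w y = Sum.inl true) ∧
    (k + 2 < i → ∀ y, y + k = w.length → tape w y = Sum.inl false)) ∨
  (p = 3 ∧ ∃ n : ℕ, 1 ≤ n ∧ w = List.replicate n false ++ List.replicate n true)

theorem final (w : List Bool) (k : ℕ) (h1 : 1 ≤ k) (h2 : k + 1 ≤ w.length)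
    (ha : ∀ x, 1 ≤ x → x ≤ k → tape w x = Sum.inl false)
    (hb : ∀ x, k < x → x < w.length + 1 → tape w x = Sum.inl true)
    (hy : ∀ y, y + k = w.length + 1 → tape w y = Sum.inl true)
    (hz : ∀ y, y + k = w.length → tape w y = Sum.inl false) :
    w = List.replicate k false ++ List.replicate k true := by
  have hl : w.length = k + k := by
    have e1 := hy (w.length + 1 - k) (by omega)
    have e2 := hz (w.length - k) (by omega)
    rcases Nat.lt_trichotomy w.length (k + k) with h | h | h
    · rw [ha _ (by omega) (by omega)] at e1; simp at e1
    · exact h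
    · rw [hb _ (by omega) (by omega)] at e2; simp at e2
  apply List.ext_getElem
  · simp [hl]
  · intro x hx hx'
    have e := tape_succ w x hx
    by_cases hk : x < k
    · rw [ha _ (by omega) (by omega)] at e
      rw [List.getElem_append_left (by simpa using hk)]
      simpa using e.symm
    · rw [hb _ (by omega) (by omega)] at e
      rw [List.getElem_append_right (by simpa using hk)]
      simpa using e.symm

theorem fwd_cases : ∀ (p p' : Fin 4) (s t : TSym Bool), fwd p s t = some p' →
    (p = 0 ∧ p' = 1 ∧ s = .inr false) ∨ (p = 1 ∧ p' = 1 ∧ s = .inl false) ∨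
    (p = 1 ∧ p' = 2 ∧ s = .inl true ∧ t = .inl true) ∨
    (p = 2 ∧ p' = 2 ∧ s = .inl true ∧ t = .inl false) ∨
    (p = 2 ∧ p' = 3 ∧ s = .inr true ∧ t = .inl false) := by
  intro p p' s t h
  unfold fwd at h
  split at h <;> simp_all

theorem inv_step (w : List Bool) (p p' : Fin 4) (i j i' j' : ℕ) (hI : Inv w p i j)
    (h : Step sys w (cf p i j) (cf p' i' j')) : Inv w p' i' j' := by
  rw [step_iff] at h
  obtain ⟨hf, hi, hj⟩ := h
  rcases fwd_cases _ _ _ _ hf with ⟨rfl, rfl, hs⟩ | ⟨rfl, rfl, hs⟩ | ⟨rfl, rfl, hs, ht⟩ |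
    ⟨rfl, rfl, hs, ht⟩ | ⟨rfl, rfl, hs, ht⟩ <;> rw [hs] at hi hj <;>
    simp only [mv1, mv2, cond_true, cond_false] at hi hj <;>
    simp only [Inv, Fin.reduceEq, zero_ne_one, one_ne_zero, true_and, false_and, or_false,
      false_or] at hI ⊢
  · obtain ⟨rfl, rfl⟩ := hI
    exact ⟨by omega, by omega, fun x _ _ => by omega⟩
  · obtain ⟨h1, h2, h3⟩ := hI
    refine ⟨by omega, by omega, fun x hx hx' => ?_⟩
    rcases Nat.lt_or_ge x i with h | h
    · exact h3 x hx h
    · obtain rfl : x = i := by omega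
      exact hs
  · obtain ⟨h1, h2, h3⟩ := hI
    have hi1 : i ≠ 1 := by
      rintro rfl
      have := tape_inl ht
      omega
    refine ⟨by omega, i - 1, by omega, by omega, fun x hx hx' => h3 x hx (by omega),
      fun x hx hx' => ?_, fun y hy => ?_, fun hk => by omega⟩
    · obtain rfl : x = i := by omega
      exact hs
    · obtain rfl : y = j := by omega
      exact ht
  · obtain ⟨h1, k, hk, hki, ha, hb, hy, hz⟩ := hI
    refine ⟨by omega, k, hk, by omega, ha, fun x hx hx' => ?_, hy, fun _ y hyk => ?_⟩
    · rcases Nat.lt_or_ge x i with h | h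
      · exact hb x hx h
      · obtain rfl : x = i := by omega
        exact hs
    · by_cases h : k + 2 < i
      · exact hz h y hyk
      · obtain rfl : y = j := by omega
        exact ht
  · obtain ⟨h1, k, hk, hki, ha, hb, hy, hz⟩ := hI
    have e1 := tape_inr_true hs
    have e2 := tape_inl ht
    obtain rfl : i = w.length + 1 := by omega
    refine ⟨k, hk, final w k hk (by omega) ha hb hy fun y hyk => ?_⟩
    by_cases h : k + 2 < w.length + 1
    · exact hz h y hyk
    · obtain rfl : y = j := by omega
      exact ht

theorem inv_reach (w : List Bool) (c : Config sys)
    (h : Relation.ReflTransGen (Step sys w) (initConf sys w) c) : Inv w c.p c.i c.j := by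
  induction h with
  | refl => exact Or.inl ⟨rfl, rfl, rfl⟩
  | tail _ hs ih => exact inv_step w _ _ _ _ _ _ ih hs

theorem halted3 (w : List Bool) (i j : ℕ) : Halted sys w (cf 3 i j) := by
  rintro ⟨⟨p', i', q', j'⟩, h⟩
  have h' := (step_iff w 3 p' i j i' j').1 h
  rcases fwd_cases _ _ _ _ h'.1 with h | h | h | h | h <;> exact absurd h.1 (by decide)

section run
variable (n : ℕ)

/-- The word `aⁿbⁿ`. -/
def wd : List Bool := List.replicate n false ++ List.replicate n true

theorem wd_len : (wd n).length = n + n := by simp [wd]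

theorem wd_a (x : ℕ) (h1 : 1 ≤ x) (h2 : x ≤ n) : tape (wd n) x = Sum.inl false := by
  obtain ⟨x, rfl⟩ := Nat.exists_eq_add_of_le' h1
  rw [tape_succ _ x (by rw [wd_len]; omega)]
  simp only [wd]
  rw [List.getElem_append_left (by simp; omega)]
  simp

theorem wd_b (x : ℕ) (h1 : n < x) (h2 : x ≤ n + n) : tape (wd n) x = Sum.inl true := by
  obtain ⟨x, rfl⟩ := Nat.exists_eq_add_of_le' (show 1 ≤ x by omega)
  rw [tape_succ _ x (by rw [wd_len]; omega)]
  simp only [wd]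
  rw [List.getElem_append_right (by simp; omega)]
  simp

theorem wd_end : tape (wd n) (n + n + 1) = Sum.inr true :=
  tape_last _ _ (by rw [wd_len])

theorem run1 (hn : 1 ≤ n) (m : ℕ) (hm : m ≤ n) :
    Relation.ReflTransGen (Step sys (wd n)) (initConf sys (wd n))
      (cf 1 (m + 1) (n + n + 1 - m)) := by
  induction m with
  | zero =>
    apply Relation.ReflTransGen.single
    have : initConf sys (wd n) = cf 0 0 (n + n + 1) := by
      simp [initConf, cf, wd_len, sys]
    rw [this, step_iff, tape_zero, wd_end]
    simp [fwd, mv1, mv2]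
  | succ m ih =>
    refine (ih (by omega)).tail ?_
    rw [step_iff, wd_a n (m + 1) (by omega) (by omega)]
    refine ⟨?_, by simp [mv1], by simp [mv2]; omega⟩
    rcases m with _ | m
    · rw [Nat.sub_zero, wd_end]; rfl
    · rw [wd_b n _ (by omega) (by omega)]; rfl

theorem run2 (hn : 1 ≤ n) (m : ℕ) (hm : m + 1 ≤ n) :
    Relation.ReflTransGen (Step sys (wd n)) (initConf sys (wd n))
      (cf 2 (n + m + 2) (n - m)) := by
  induction m with
  | zero =>
    refine (run1 n hn n le_rfl).tail ?_
    rw [step_iff, wd_b n (n + 1) (by omega) (by omega), wd_b n _ (by omega) (by omega)]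
    exact ⟨rfl, by simp [mv1], by simp [mv2]; omega⟩
  | succ m ih =>
    refine (ih (by omega)).tail ?_
    rw [step_iff, wd_b n (n + m + 2) (by omega) (by omega), wd_a n _ (by omega) (by omega)]
    exact ⟨rfl, by simp [mv1]; omega, by simp [mv2]; omega⟩

theorem run3 (hn : 1 ≤ n) :
    Relation.ReflTransGen (Step sys (wd n)) (initConf sys (wd n))
      (cf 3 (n + n + 1) 0) := by
  refine (run2 n hn (n - 1) (by omega)).tail ?_
  have e : n + (n - 1) + 2 = n + n + 1 := by omega
  rw [e, step_iff, wd_end, wd_a n _ (by omega) (by omega)]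
  exact ⟨rfl, by simp [mv1], by simp [mv2]; omega⟩

end run

theorem accepts_of_reach (w : List Bool) (c : Config sys)
    (h : Relation.ReflTransGen (Step sys w) (initConf sys w) c)
    (hh : Halted sys w c) (ha : AccConf sys c) : Accepts sys w := by
  obtain ⟨l, hl, hlast⟩ := List.exists_isChain_cons_of_relationReflTransGen h
  exact ⟨_ :: l, rfl, hl, c, by rw [List.getLast?_eq_some_getLast (by simp), hlast], hh, ha⟩

theorem reach_of_chain (w : List Bool) (cs : List (Config sys)) : ∀ (c0 c : Config sys),
    cs.head? = some c0 → List.IsChain (Step sys w) cs → cs.getLast? = some c →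
    Relation.ReflTransGen (Step sys w) c0 c := by
  induction cs with
  | nil => intro c0 c h; simp at h
  | cons a l ih =>
    intro c0 c h hc hl
    obtain rfl : a = c0 := by simpa using h
    cases l with
    | nil =>
      obtain rfl : a = c := by simpa using hl
      exact .refl
    | cons b l =>
      rw [List.isChain_cons_cons] at hc
      exact .head hc.1 (ih b c rfl hc.2 (by simpa using hl))

theorem sys_lang : lang sys = { w : List Bool | ∃ n : ℕ, 1 ≤ n ∧
        w = List.replicate n false ++ List.replicate n true } := by
  ext w
  constructor
  · rintro ⟨cs, h1, h2, c, h3, -, h4⟩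
    have hI := inv_reach w c (reach_of_chain w cs _ c h1 h2 h3)
    have hp : c.p = (3 : Fin 4) := by
      rcases h4 with h | h
      · exact h
      · exact absurd h (Set.notMem_empty _)
    rw [hp] at hI
    rcases hI with h | h | h | h
    · exact absurd h.1 (by decide)
    · exact absurd h.1 (by decide)
    · exact absurd h.1 (by decide)
    · exact h.2
  · rintro ⟨n, hn, rfl⟩
    exact accepts_of_reach _ _ (run3 n hn) (halted3 _ _ _) (Or.inl rfl)

end WK

open WK in
/-- The language `L = { aⁿbⁿ : n ≥ 1 }` (over the alphabet `{a,b}`,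
modelled as `Bool` with `a = false`, `b = true`) is accepted by some reversible
deterministic two-party Watson-Crick system. -/
theorem anbn_accepted_by_REV_PWK :
    ∃ A : DPWK Bool, Reversible A ∧
      lang A = { w : List Bool | ∃ n : ℕ, 1 ≤ n ∧
        w = List.replicate n false ++ List.replicate n true } := by
  exact ⟨sys, sys_rev, sys_lang⟩
end

section
/- There exists a regular language that is not accepted by any reversible deterministic two-party Watson-Crick system. -/
namespace WKP

abbrev Sy := Bool ⊕ Bool

/-- Abstract two-tape machine. -/
structure Mc (S : Type) where
  G : Sy → Sy → S → Option (S × Bool × Bool)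
  e1 : Sy
  e2 : Sy
  l : Sy
  r : Sy
  s0 : S
  F : S → Prop

variable {S : Type}

def Mc.sw (M : Mc S) : Mc S where
  G := fun x y s => (M.G y x s).map (fun p => (p.1, p.2.2, p.2.1))
  e1 := M.e2
  e2 := M.e1
  l := M.r
  r := M.l
  s0 := M.s0
  F := M.F

def mv (d : Bool) (R : List Sy) : List Sy := if d then R.tail else R

@[simp] theorem mv_true (R : List Sy) : mv true R = R.tail := rfl
@[simp] theorem mv_false (R : List Sy) : mv false R = R := rfl

def Mc.Inj (M : Mc S) : Prop := ∀ x y s s' t d1 d2 d1' d2',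
  M.G x y s = some (t, d1, d2) → M.G x y s' = some (t, d1', d2') → s = s'

inductive Run (M : Mc S) : S → List Sy → List Sy → S → List Sy → List Sy → Prop
  | refl (s R1 R2) : Run M s R1 R2 s R1 R2
  | step {s R1 R2 t d1 d2 s' R1' R2'} :
      M.G (R1.headD M.e1) (R2.headD M.e2) s = some (t, d1, d2) →
      Run M t (mv d1 R1) (mv d2 R2) s' R1' R2' → Run M s R1 R2 s' R1' R2'

inductive Acc (M : Mc S) : S → List Sy → List Sy → Prop
  | halt {s R1 R2} : M.G (R1.headD M.e1) (R2.headD M.e2) s = none → M.F s → Acc M s R1 R2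
  | step {s R1 R2 t d1 d2} :
      M.G (R1.headD M.e1) (R2.headD M.e2) s = some (t, d1, d2) →
      Acc M t (mv d1 R1) (mv d2 R2) → Acc M s R1 R2

inductive UPass (M : Mc S) (x y : Sy) : S → S → ℕ → Prop
  | move {s t d} : M.G x y s = some (t, true, d) → UPass M x y s t d.toNat
  | stay {s s1 t d k} : M.G x y s = some (s1, false, d) → UPass M x y s1 t k →
      UPass M x y s t (k + d.toNat)

inductive UWalk (M : Mc S) (y : Sy) : S → List Sy → S → ℕ → Prop
  | nil (s) : UWalk M y s [] s 0
  | cons {s x s1 k1 Z t k2} : UPass M x y s s1 k1 → UWalk M y s1 Z t k2 →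
      UWalk M y s (x :: Z) t (k1 + k2)

abbrev rp (n : ℕ) (y : Sy) : List Sy := List.replicate n y

variable {M : Mc S}

theorem sw_G_iff {x y s t d1 d2} : M.sw.G y x s = some (t, d2, d1) ↔ M.G x y s = some (t, d1, d2) := by
  rcases h : M.G x y s with _ | ⟨a, b, c⟩
  · simp [Mc.sw, h]
  · simp [Mc.sw, h]; tauto

theorem sw_G_none {x y s} : M.sw.G y x s = none ↔ M.G x y s = none := by
  simp [Mc.sw]

theorem Inj.sw (h : M.Inj) : M.sw.Inj := by
  intro x y s s' t d1 d2 d1' d2' h1 h2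
  exact h _ _ _ _ _ _ _ _ _ (sw_G_iff.1 h1) (sw_G_iff.1 h2)

theorem sw_sw : M.sw.sw = M := by
  have : M.sw.sw.G = M.G := by
    funext x y s
    rcases h : M.G x y s with _ | ⟨a, b, c⟩ <;> simp [Mc.sw, h]
  cases M
  simp only [Mc.sw] at this ⊢
  congr

theorem Run.sw {s R1 R2 s' R1' R2'} (h : Run M s R1 R2 s' R1' R2') :
    Run M.sw s R2 R1 s' R2' R1' := by
  induction h with
  | refl => exact .refl _ _ _
  | step h1 _ ih => exact .step (sw_G_iff.2 h1) ih

theorem Run.of_sw {s R1 R2 s' R1' R2'} (h : Run M.sw s R2 R1 s' R2' R1') :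
    Run M s R1 R2 s' R1' R2' := by
  have := h.sw
  rwa [sw_sw] at this

theorem Acc.sw {s R1 R2} (h : Acc M s R1 R2) : Acc M.sw s R2 R1 := by
  induction h with
  | halt h1 h2 => exact .halt (sw_G_none.2 h1) h2
  | step h1 _ ih => exact .step (sw_G_iff.2 h1) ih

theorem Acc_sw {s R1 R2} : Acc M.sw s R2 R1 ↔ Acc M s R1 R2 := by
  constructor
  · intro h
    have := h.sw
    rwa [sw_sw] at this
  · exact Acc.sw

theorem Run.trans {s R1 R2 s' R1' R2' s'' R1'' R2''} (h : Run M s R1 R2 s' R1' R2')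
    (h' : Run M s' R1' R2' s'' R1'' R2'') : Run M s R1 R2 s'' R1'' R2'' := by
  induction h with
  | refl => exact h'
  | step h1 _ ih => exact .step h1 (ih h')

theorem Acc_step {s R1 R2 t d1 d2}
    (h : M.G (R1.headD M.e1) (R2.headD M.e2) s = some (t, d1, d2)) :
    Acc M s R1 R2 ↔ Acc M t (mv d1 R1) (mv d2 R2) := by
  constructor
  · intro h'
    cases h' with
    | halt h1 => rw [h] at h1; cases h1
    | step h1 h2 => rw [h] at h1; cases h1; exact h2
  · exact .step h

theorem Run.acc {s R1 R2 s' R1' R2'} (h : Run M s R1 R2 s' R1' R2') :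
    Acc M s R1 R2 ↔ Acc M s' R1' R2' := by
  induction h with
  | refl => rfl
  | step h1 _ ih => rw [Acc_step h1, ih]

theorem UPass.det {x y s t k t' k'} (h : UPass M x y s t k) (h' : UPass M x y s t' k') :
    t = t' ∧ k = k' := by
  induction h generalizing t' k' with
  | move h1 =>
    cases h' with
    | move h2 => rw [h1] at h2; cases h2; simp
    | stay h2 => rw [h1] at h2; cases h2
  | stay h1 _ ih =>
    cases h' with
    | move h2 => rw [h1] at h2; cases h2
    | stay h2 h3 => rw [h1] at h2; cases h2; simp [ih h3]

theorem UWalk.det {y s Z t k t' k'} (h : UWalk M y s Z t k) (h' : UWalk M y s Z t' k') :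
    t = t' ∧ k = k' := by
  induction h generalizing t' k' with
  | nil => cases h'; simp
  | cons h1 _ ih =>
    cases h' with
    | cons h2 h3 =>
      obtain ⟨rfl, rfl⟩ := h1.det h2
      obtain ⟨rfl, rfl⟩ := ih h3
      simp

theorem UWalk.append {y s Z t k Z' t' k'} (h : UWalk M y s Z t k) (h' : UWalk M y t Z' t' k') :
    UWalk M y s (Z ++ Z') t' (k + k') := by
  induction h with
  | nil => simpa using h'
  | cons h1 _ ih => rw [add_assoc]; exact .cons h1 (ih h')

theorem UWalk.split {y s Z Z' t' k'} (h : UWalk M y s (Z ++ Z') t' k') :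
    ∃ t k1 k2, UWalk M y s Z t k1 ∧ UWalk M y t Z' t' k2 ∧ k' = k1 + k2 := by
  induction Z generalizing s k' with
  | nil => exact ⟨s, 0, k', .nil _, h, by simp⟩
  | cons x Z ih =>
    cases h with
    | cons h1 h2 =>
      obtain ⟨t, k1, k2, h3, h4, rfl⟩ := ih h2
      exact ⟨t, _, k2, .cons h1 h3, h4, by omega⟩

theorem UPass.walk {x y s t k} (h : UPass M x y s t k) : UWalk M y s [x] t k := by
  simpa using UWalk.cons h (.nil _)

theorem UWalk.pass {x y s t k} (h : UWalk M y s [x] t k) : UPass M x y s t k := by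
  cases h with
  | cons h1 h2 => cases h2; simpa using h1

theorem rep_mv (d : Bool) (k n : ℕ) (y : Sy) (V : List Sy) :
    mv d (rp (k + d.toNat + (n+1)) y ++ V) = rp (k + (n+1)) y ++ V := by
  cases d
  · simp
  · have : k + true.toNat + (n+1) = (k + (n+1)) + 1 := by simp; omega
    rw [this]; simp [List.replicate_succ]

theorem rep_head (n : ℕ) (y e : Sy) (V : List Sy) (h : 0 < n) :
    (rp n y ++ V).headD e = y := by
  obtain ⟨n, rfl⟩ := Nat.exists_eq_succ_of_ne_zero h.ne'
  simp [List.replicate_succ]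

theorem UPass.run' {x y s t k} (h : UPass M x y s t k) (n : ℕ) (T V) :
    Run M s (x :: T) (rp (k + (n+1)) y ++ V) t T (rp (n+1) y ++ V) := by
  induction h with
  | @move s t d h1 =>
    refine .step (d1 := true) (d2 := d) (t := t) ?_ ?_
    · rw [rep_head _ _ _ _ (by omega)]; exact h1
    · have := rep_mv d 0 n y V
      simp only [Nat.zero_add] at this
      rw [this]; exact .refl _ _ _
  | @stay s s1 t d k h1 _ ih =>
    refine .step (d1 := false) (d2 := d) (t := s1) ?_ ?_
    · rw [rep_head _ _ _ _ (by omega)]; exact h1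
    · rw [rep_mv]; exact ih

theorem UPass.run {x y s t k} (h : UPass M x y s t k) {n : ℕ} (hn : k < n) (T V) :
    Run M s (x :: T) (rp n y ++ V) t T (rp (n-k) y ++ V) := by
  obtain ⟨j, rfl⟩ : ∃ j, n = k + (j+1) := ⟨n-k-1, by omega⟩
  rw [show k + (j+1) - k = j+1 by omega]
  exact h.run' j T V

theorem UPass.run_nil {x s t k} (h : UPass M x M.e2 s t k) (T) :
    Run M s (x :: T) [] t T [] := by
  induction h with
  | @move s t d h1 => exact .step h1 (by cases d <;> exact .refl _ _ _)
  | @stay s s1 t d k h1 _ ih => exact .step h1 (by cases d <;> exact ih)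

theorem UWalk.run {y s Z t k} (h : UWalk M y s Z t k) {n : ℕ} (hn : k < n) (T V) :
    Run M s (Z ++ T) (rp n y ++ V) t T (rp (n-k) y ++ V) := by
  induction h generalizing n with
  | nil => exact .refl _ _ _
  | @cons s x s1 k1 Z t k2 h1 _ ih =>
    refine (h1.run (by omega) _ _).trans ?_
    have := ih (n := n - k1) (by omega)
    rwa [Nat.sub_sub] at this

theorem UWalk.run_nil {s Z t k} (h : UWalk M M.e2 s Z t k) (T) :
    Run M s (Z ++ T) [] t T [] := by
  generalize hy : M.e2 = y at h
  induction h with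
  | nil => exact .refl _ _ _
  | cons h1 _ ih => subst hy; exact (h1.run_nil _).trans ih

/-- a `0`-displacement walk of the lower head. -/
theorem UWalk.run_sw {x s Z t} (h : UWalk M.sw x s Z t 0) (T V) :
    Run M s (x :: T) (Z ++ V) t (x :: T) V := by
  have := h.run (n := 1) (by omega) V T
  exact Run.of_sw (by simpa using this)

def Dead (M : Mc S) (s : S) (Z R : List Sy) : Prop :=
  ∀ T T' V V', Acc M s (Z ++ T) (R ++ V) ↔ Acc M s (Z ++ T') (R ++ V')

def IndT (M : Mc S) (s : S) (Z R : List Sy) : Prop :=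
  ∀ T T', Acc M s (Z ++ T) R ↔ Acc M s (Z ++ T') R

theorem Dead.mono {s Z R} (h : Dead M s Z R) (Z' R') : Dead M s (Z ++ Z') (R ++ R') := by
  intro T T' V V'
  simp only [List.append_assoc]
  exact h _ _ _ _

theorem Dead.monoL {s Z R} (h : Dead M s Z R) (Z') : Dead M s (Z ++ Z') R := by
  simpa using h.mono Z' []

theorem Dead.monoR {s Z R} (h : Dead M s Z R) (R') : Dead M s Z (R ++ R') := by
  simpa using h.mono [] R'

theorem Dead.of_run {s Z R s' Z' R'}
    (hr : ∀ T V, Run M s (Z ++ T) (R ++ V) s' (Z' ++ T) (R' ++ V)) (h : Dead M s' Z' R') :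
    Dead M s Z R := by
  intro T T' V V'
  rw [(hr T V).acc, (hr T' V').acc]
  exact h _ _ _ _

theorem IndT.mono {s Z R} (h : IndT M s Z R) (Z') : IndT M s (Z ++ Z') R := by
  intro T T'
  simp only [List.append_assoc]
  exact h _ _

theorem IndT.of_run {s Z R s' Z' R'}
    (hr : ∀ T, Run M s (Z ++ T) R s' (Z' ++ T) R') (h : IndT M s' Z' R') :
    IndT M s Z R := by
  intro T T'
  rw [(hr T).acc, (hr T').acc]
  exact h _ _

theorem Dead.indT {s Z R} (h : Dead M s Z R) (V) : IndT M s Z (R ++ V) := fun T T' => h T T' V V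

theorem UPass.bound [Finite S] (M : Mc S) : ∃ B, ∀ x y s t k, UPass M x y s t k → k ≤ B := by
  have : ∀ p : Sy × Sy × S, ∃ b, ∀ t k, UPass M p.1 p.2.1 p.2.2 t k → k ≤ b := by
    intro p
    by_cases h : ∃ t k, UPass M p.1 p.2.1 p.2.2 t k
    · obtain ⟨t, k, h⟩ := h
      exact ⟨k, fun t' k' h' => (h.det h').2.ge⟩
    · exact ⟨0, fun t k h' => (h ⟨t, k, h'⟩).elim⟩
  choose f hf using this
  have := Fintype.ofFinite S
  refine ⟨Finset.univ.sup f, fun x y s t k h => ?_⟩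
  exact (hf (x, y, s) t k h).trans (Finset.le_sup (f := f) (Finset.mem_univ (x, y, s)))

theorem UWalk.bound {B} (hB : ∀ x y s t k, UPass M x y s t k → k ≤ B) {y s Z t k}
    (h : UWalk M y s Z t k) : k ≤ B * Z.length := by
  induction h with
  | nil => simp
  | cons h1 _ ih => have := hB _ _ _ _ _ h1; simp [mul_add]; omega

/-! swap and passes -/

theorem UPass.sw_zero {x y s t k} (h : UPass M.sw y x s t k) :
    k = 0 ∨ ∃ t' k', UPass M x y s t' k' := by
  induction h with
  | @move s t d h1 =>
    rw [sw_G_iff] at h1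
    cases d
    · left; rfl
    · right; exact ⟨_, _, .move h1⟩
  | @stay s s1 t d k h1 _ ih =>
    rw [sw_G_iff] at h1
    cases d
    · rcases ih with rfl | ⟨t', k', h⟩
      · left; rfl
      · right; exact ⟨_, _, .stay h1 h⟩
    · right; exact ⟨_, _, .move h1⟩

theorem UPass.sw_back {x y s t k} (h : UPass M.sw y x s t k) {t' k'} (h' : UPass M x y t t' k') :
    ∃ t' k', UPass M x y s t' k' := by
  induction h with
  | @move s t d h1 =>
    rw [sw_G_iff] at h1
    cases d
    · exact ⟨_, _, .stay h1 h'⟩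
    · exact ⟨_, _, .move h1⟩
  | @stay s s1 t d k h1 _ ih =>
    rw [sw_G_iff] at h1
    cases d
    · obtain ⟨_, _, h⟩ := ih h'
      exact ⟨_, _, .stay h1 h⟩
    · exact ⟨_, _, .move h1⟩

theorem dead_basic_aux {x y s} {R1 R2 : List Sy} (h : Acc M s R1 R2)
    (h1 : ¬ ∃ t k, UPass M x y s t k) (h2 : ¬ ∃ t k, UPass M.sw y x s t k)
    (T V T' V') (e1 : R1 = x :: T) (e2 : R2 = y :: V) : Acc M s (x :: T') (y :: V') := by
  induction h with
  | halt h3 h4 => subst e1 e2; exact .halt h3 h4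
  | @step s R1 R2 t d1 d2 h3 h4 ih =>
    subst e1 e2
    refine .step h3 ?_
    simp at h3
    cases d1
    · cases d2
      · refine ih ?_ ?_ rfl rfl
        · rintro ⟨t', k', h⟩; exact h1 ⟨_, _, .stay h3 h⟩
        · rintro ⟨t', k', h⟩; exact h2 ⟨_, _, .stay (sw_G_iff.2 h3) h⟩
      · exact (h2 ⟨_, _, .move (sw_G_iff.2 h3)⟩).elim
    · exact (h1 ⟨_, _, .move h3⟩).elim

theorem dead_basic {x y s} (h1 : ¬ ∃ t k, UPass M x y s t k)
    (h2 : ¬ ∃ t k, UPass M.sw y x s t k) : Dead M s [x] [y] := by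
  intro T T' V V'
  exact ⟨fun h => dead_basic_aux h h1 h2 _ _ _ _ rfl rfl,
    fun h => dead_basic_aux h h1 h2 _ _ _ _ rfl rfl⟩

theorem phase {x y s} (h : ¬ ∃ t k, UPass M x y s t k) (n : ℕ) :
    (∃ s', UWalk M.sw x s (rp n y) s' 0 ∧ ¬ ∃ t k, UPass M x y s' t k) ∨ Dead M s [x] (rp n y) := by
  induction n generalizing s with
  | zero => left; exact ⟨s, .nil _, h⟩
  | succ n ih =>
    by_cases h2 : ∃ t k, UPass M.sw y x s t k
    · obtain ⟨t, k, h2⟩ := h2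
      obtain rfl : k = 0 := h2.sw_zero.resolve_right h
      have h3 : ¬ ∃ t' k, UPass M x y t t' k := by
        rintro ⟨t', k', h3⟩; exact h (h2.sw_back h3)
      rcases ih h3 with ⟨s', h4, h5⟩ | h4
      · left; exact ⟨s', by simpa [List.replicate_succ] using UWalk.cons h2 h4, h5⟩
      · right
        refine Dead.of_run (fun T V => ?_) h4
        have := h2.walk.run_sw T (rp n y ++ V)
        simpa [List.replicate_succ] using this
    · right
      have := (dead_basic h h2).monoR (rp n y)
      simpa [List.replicate_succ] using this

end WKP

set_option linter.unusedSectionVars false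
namespace WKP
variable {S : Type} {M : Mc S}

def pw (Z : List Sy) (c : ℕ) : List Sy := (List.replicate c Z).flatten

@[simp] theorem pw_zero (Z) : pw Z 0 = [] := rfl
theorem pw_succ (Z c) : pw Z (c+1) = Z ++ pw Z c := by simp [pw, List.replicate_succ]
theorem pw_add (Z c d) : pw Z (c+d) = pw Z c ++ pw Z d := by
  simp [pw, ← List.replicate_append_replicate]
theorem pw_succ' (Z c) : pw Z (c+1) = pw Z c ++ Z := by
  rw [pw_add]; simp [pw]
@[simp] theorem pw_one (Z) : pw Z 1 = Z := by simp [pw]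
theorem pw_single (x c) : pw [x] c = rp c x := by
  induction c with
  | zero => rfl
  | succ c ih => simp [pw_succ, ih, List.replicate_succ]
theorem pw_mul (Z a b) : pw Z (a*b) = pw (pw Z a) b := by
  induction b with
  | zero => rfl
  | succ b ih => rw [Nat.mul_succ, pw_add, ih, pw_succ']
theorem rp_add (a b x) : rp (a+b) x = rp a x ++ rp b x := by simp [rp]
theorem rp_succ (a x) : rp (a+1) x = x :: rp a x := by simp [rp, List.replicate_succ]

theorem UWalk.seq {y s Z t c k} (h : UWalk M y s (pw Z c) t k) :
    ∃ (f : ℕ → S) (κ : ℕ → ℕ), f 0 = s ∧ f c = t ∧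
      ∀ i < c, UWalk M y (f i) Z (f (i+1)) (κ i) ∧ κ i ≤ k := by
  induction c generalizing s k with
  | zero => cases h; exact ⟨fun _ => t, fun _ => 0, rfl, rfl, by simp⟩
  | succ c ih =>
    rw [pw_succ] at h
    obtain ⟨s1, k1, k2, h1, h2, rfl⟩ := h.split
    obtain ⟨f, κ, rfl, rfl, hf⟩ := ih h2
    refine ⟨fun i => Nat.casesOn i s f, fun i => Nat.casesOn i k1 κ, rfl, rfl, ?_⟩
    intro i hi
    cases i with
    | zero => exact ⟨h1, by simp⟩
    | succ i => have := hf i (by omega); exact ⟨this.1, by simp; omega⟩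

theorem UWalk.ofSeq {y Z} (f : ℕ → S) (κ : ℕ → ℕ) (c : ℕ)
    (h : ∀ i < c, UWalk M y (f i) Z (f (i+1)) (κ i)) :
    UWalk M y (f 0) (pw Z c) (f c) (∑ i ∈ Finset.range c, κ i) := by
  induction c with
  | zero => exact .nil _
  | succ c ih =>
    rw [pw_succ', Finset.sum_range_succ]
    exact (ih fun i hi => h i (by omega)).append (h c (by omega))

theorem UWalk.loop {y s Z e} (h : UWalk M y s Z s e) (q : ℕ) : UWalk M y s (pw Z q) s (q * e) := by
  have := UWalk.ofSeq (y := y) (Z := Z) (M := M) (fun _ => s) (fun _ => e) q (fun _ _ => h)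
  simpa using this

section fin
variable [Fintype S]

theorem per (R : S → S → Prop) (hR : ∀ a b c, R a c → R b c → a = b) (f : ℕ → S) (L : ℕ)
    (hf : ∀ i < L, R (f i) (f (i+1))) (hL : Fintype.card S ≤ L) :
    ∃ r, 1 ≤ r ∧ r ≤ Fintype.card S ∧ f r = f 0 := by
  obtain ⟨i, j, hij, h⟩ := Fintype.exists_ne_map_eq_of_card_lt
    (fun i : Fin (Fintype.card S + 1) => f i) (by simp)
  wlog hlt : i < j generalizing i j
  · exact this j i hij.symm h.symm (lt_of_le_of_ne (not_lt.1 hlt) hij.symm)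
  have key : ∀ a d : ℕ, a + d ≤ L → f a = f (a + d) → f 0 = f d := by
    intro a d
    induction a with
    | zero => simp
    | succ a ih =>
      intro h1 h2
      apply ih (by omega)
      apply hR _ _ _ (hf a (by omega))
      have := hf (a + d) (by omega)
      rwa [show a + d + 1 = a + 1 + d by omega, ← h2] at this
  have hj := j.2
  have hlt' : (i : ℕ) < j := hlt
  refine ⟨j - i, by omega, by omega, ?_⟩
  have := key i (j - i) (by omega) (by rw [Nat.add_sub_cancel' hlt'.le]; exact h)
  exact this.symm

end fin

def Arr (M : Mc S) (x y : Sy) (s : S) : Prop := ∃ u d, M.G x y u = some (s, true, d)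

theorem UPass.arr {x y s t k} (h : UPass M x y s t k) : Arr M x y t := by
  induction h with
  | move h1 => exact ⟨_, _, h1⟩
  | stay _ _ ih => exact ih

def Stay (M : Mc S) (x y : Sy) (s t : S) : Prop := ∃ d, M.G x y s = some (t, false, d)

theorem UPass.chain {x y s t k} (h : UPass M x y s t k) :
    ∃ u d, Relation.ReflTransGen (Stay M x y) s u ∧ M.G x y u = some (t, true, d) := by
  induction h with
  | move h1 => exact ⟨_, _, .refl, h1⟩
  | stay h1 _ ih =>
    obtain ⟨u, d, h2, h3⟩ := ih
    exact ⟨u, d, .head ⟨_, h1⟩ h2, h3⟩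

theorem UPass.chain0 {x y s t} (h : UPass M.sw y x s t 0) :
    Relation.TransGen (Stay M x y) s t := by
  generalize hk : 0 = k at h
  induction h with
  | @move s t d h1 =>
    cases d
    · exact .single ⟨_, sw_G_iff.1 h1⟩
    · simp at hk
  | @stay s s1 t d k h1 _ ih =>
    cases d
    · exact .head ⟨_, sw_G_iff.1 h1⟩ (ih (by simpa using hk))
    · simp at hk

theorem stay_last (hI : M.Inj) {x y s t} (h : Relation.TransGen (Stay M x y) s t) :
    ¬ Arr M x y t := by
  rintro ⟨u, d, hu⟩
  obtain ⟨v, hv, d', hv'⟩ := Relation.TransGen.tail'_iff.1 h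
  have := hI _ _ _ _ _ _ _ _ _ hu hv'
  subst this
  rw [hu] at hv'
  simp at hv'

theorem pass_inj (hI : M.Inj) {x y s s' t k k'} (ha : Arr M x y s) (ha' : Arr M x y s')
    (h : UPass M x y s t k) (h' : UPass M x y s' t k') : s = s' := by
  obtain ⟨u, d, hu, hu2⟩ := h.chain
  obtain ⟨v, d', hv, hv2⟩ := h'.chain
  obtain rfl := hI _ _ _ _ _ _ _ _ _ hu2 hv2
  have hru : Relator.RightUnique (Function.swap (Stay M x y)) := by
    rintro a b c ⟨d1, h1⟩ ⟨d2, h2⟩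
    exact hI _ _ _ _ _ _ _ _ _ h1 h2
  have h1 := Relation.reflTransGen_swap.2 hu
  have h2 := Relation.reflTransGen_swap.2 hv
  rcases Relation.ReflTransGen.total_of_right_unique hru h1 h2 with h3 | h3
  · have h3 := Relation.reflTransGen_swap.1 h3
    rcases Relation.reflTransGen_iff_eq_or_transGen.1 h3 with h4 | h4
    · exact h4
    · exact (stay_last hI h4 ha).elim
  · have h3 := Relation.reflTransGen_swap.1 h3
    rcases Relation.reflTransGen_iff_eq_or_transGen.1 h3 with h4 | h4
    · exact h4.symm
    · exact (stay_last hI h4 ha').elim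

section fin
variable [Fintype S]

variable (S) in
def cm : ℕ := Fintype.card S
variable (S) in
def La : ℕ := (cm S).factorial
variable (S) in
def nn : ℕ := 1 + La S * La S

theorem La_pos : 0 < La S := Nat.factorial_pos _
theorem cm_le_La : cm S ≤ La S := Nat.self_le_factorial _
theorem dvd_La {r} (h : 1 ≤ r) (h' : r ≤ cm S) : r ∣ La S := Nat.dvd_factorial h h'
theorem cm_lt_nn : cm S + 1 ≤ nn S := by
  have := cm_le_La (S := S)
  have h2 := Nat.le_mul_self (La S)
  unfold nn; omega

theorem block0 (hI : M.Inj) {x y s t k} (h : UWalk M y s (rp (cm S + 1) x) t k) :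
    ∃ t1 k1 r e, UPass M x y s t1 k1 ∧ 1 ≤ r ∧ r ≤ cm S ∧ UWalk M y t1 (rp r x) t1 e ∧
      (k = 0 → k1 = 0 ∧ e = 0) := by
  rw [rp_succ] at h
  cases h with
  | @cons _ _ t1 k1 _ _ k2 h1 h2 =>
  rw [← pw_single] at h2
  obtain ⟨f, κ, hf0, hf1, hf⟩ := h2.seq
  have harr : ∀ i ≤ cm S, Arr M x y (f i) := by
    intro i hi
    cases i with
    | zero => rw [hf0]; exact h1.arr
    | succ i => exact (hf i (by omega)).1.pass.arr
  obtain ⟨r, hr1, hr2, hr⟩ := per (fun a c => Arr M x y a ∧ ∃ k, UPass M x y a c k)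
    (fun a b c ⟨h1, _, h2⟩ ⟨h3, _, h4⟩ => pass_inj hI h1 h3 h2 h4) f (cm S)
    (fun i hi => ⟨harr i hi.le, _, (hf i hi).1.pass⟩) le_rfl
  have hr2' : r ≤ cm S := hr2
  have := UWalk.ofSeq (y := y) (Z := [x]) (M := M) f κ r (fun i hi => (hf i (by omega)).1)
  rw [hr, hf0, pw_single] at this
  refine ⟨t1, k1, r, _, h1, hr1, hr2, this, fun hk => ⟨by omega, ?_⟩⟩
  apply Finset.sum_eq_zero
  intro i hi
  have := (hf i (by simp at hi; omega)).2
  omega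

theorem block (hI : M.Inj) {x y s t k} (h : UWalk M y s (rp (cm S + 1) x) t k) :
    ∃ t1 k1 e, UPass M x y s t1 k1 ∧ UWalk M y t1 (rp (La S) x) t1 e ∧
      (k = 0 → k1 = 0 ∧ e = 0) := by
  obtain ⟨t1, k1, r, e, h1, hr1, hr2, h2, h3⟩ := block0 hI h
  obtain ⟨q, hq⟩ := dvd_La hr1 hr2
  refine ⟨t1, k1, q * e, h1, ?_, fun hk => ⟨(h3 hk).1, by simp [(h3 hk).2]⟩⟩
  have := h2.loop q
  rwa [← pw_single, ← pw_mul, pw_single, ← hq] at this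

theorem block_q {x y s t1 k1 e} (h1 : UPass M x y s t1 k1)
    (h2 : UWalk M y t1 (rp (La S) x) t1 e) (q : ℕ) :
    UWalk M y s (rp (1 + q * La S) x) t1 (k1 + q * e) := by
  rw [rp_add]
  refine UWalk.append h1.walk ?_
  have := h2.loop q
  rwa [← pw_single, ← pw_mul, pw_single, mul_comm] at this

/-- re-sizing of blocks -/
theorem resize (hI : M.Inj) {x y s t k h} (hh : cm S ≤ h * La S)
    (hw : UWalk M y s (rp (1 + h * La S) x) t k) (q : ℕ) :
    ∃ k', UWalk M y s (rp (1 + q * La S) x) t k' ∧ (k = 0 → k' = 0) := by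
  obtain ⟨j, hj⟩ : ∃ j, 1 + h * La S = (cm S + 1) + j := ⟨h * La S - cm S, by omega⟩
  have hw' := hw
  rw [hj, rp_add] at hw'
  obtain ⟨t', k1, k2, h1, h2, rfl⟩ := hw'.split
  obtain ⟨t1, k1', e, h3, h4, h5⟩ := block hI h1
  obtain ⟨rfl, -⟩ := (block_q h3 h4 h).det hw
  refine ⟨_, block_q h3 h4 q, fun hk => ?_⟩
  have := h5 (by omega)
  simp [this.1, this.2]

theorem walk_any (hI : M.Inj) {x y s t k} (h : UWalk M y s (rp (cm S + 1) x) t k) (j : ℕ) :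
    ∃ t k, UWalk M y s (rp j x) t k := by
  obtain ⟨t1, k1, e, h1, h2, h3⟩ := block hI h
  have := block_q h1 h2 j
  have hl : j ≤ 1 + j * La S := by
    have := Nat.le_mul_of_pos_right j (La_pos (S := S)); omega
  rw [show 1 + j * La S = j + (1 + j * La S - j) by omega, rp_add] at this
  obtain ⟨t, k, _, h, _⟩ := this.split
  exact ⟨t, k, h⟩

theorem no_stuck (hI : M.Inj) {x y t s'} (ha : Arr M x y t)
    (h : UWalk M.sw x t (rp (cm S + 1) y) s' 0) : False := by
  obtain ⟨t1, k1, r, e, h1, hr1, hr2, h2, h3⟩ := block0 (Inj.sw hI) h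
  obtain ⟨rfl, rfl⟩ := h3 rfl
  have c1 := h1.chain0
  have c2 : Relation.TransGen (Stay M x y) t1 t1 := by
    obtain ⟨r, rfl⟩ : ∃ r', r = r' + 1 := ⟨r - 1, by omega⟩
    clear hr1 hr2 h h1 c1 h3
    have key : ∀ r u, ∀ k, UWalk M.sw x u (rp (r+1) y) t1 k → k = 0 →
        Relation.TransGen (Stay M x y) u t1 := by
      intro r
      induction r with
      | zero =>
        intro u k hu hk
        subst hk
        exact (UWalk.pass (by simpa using hu)).chain0
      | succ r ih =>
        intro u k hu hk
        rw [rp_succ] at hu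
        cases hu with
        | @cons _ _ s1 k1 _ _ k2 h1 h2 =>
          obtain rfl : k1 = 0 := by omega
          exact h1.chain0.trans (ih _ _ h2 (by omega))
    exact key r t1 0 h2 rfl
  have c3 : Relation.TransGen (Stay M x y) t t := by
    have := c1.to_reflTransGen
    clear c1 h1 h ha
    induction this using Relation.ReflTransGen.head_induction_on with
    | refl => exact c2
    | head h1 _ ih =>
      obtain ⟨p, hp, d, hp2⟩ := Relation.TransGen.tail'_iff.1 ih
      obtain ⟨d', h1'⟩ := h1
      obtain rfl := hI _ _ _ _ _ _ _ _ _ hp2 h1'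
      exact Relation.TransGen.head' ⟨_, h1'⟩ hp
  exact stay_last hI c3 ha

theorem evper {y s Z t k} (h : UWalk M y s (pw Z (cm S)) t k) :
    ∃ (f : ℕ → S) (κ : ℕ → ℕ), f 0 = s ∧ (∀ i, UWalk M y (f i) Z (f (i+1)) (κ i)) ∧
      (∀ i, cm S ≤ i → f (i + La S) = f i) ∧ (k = 0 → ∀ i, κ i = 0) := by
  obtain ⟨f, κ, hf0, hf1, hf⟩ := h.seq
  obtain ⟨i, j, hij, h⟩ := Fintype.exists_ne_map_eq_of_card_lt
    (fun i : Fin (Fintype.card S + 1) => f i) (by simp)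
  wlog hlt : i < j generalizing i j
  · exact this j i hij.symm h.symm (lt_of_le_of_ne (not_lt.1 hlt) hij.symm)
  obtain ⟨i, hi⟩ := i
  obtain ⟨j, hj⟩ := j
  simp only [Fin.mk_lt_mk] at hlt
  simp only at h
  obtain ⟨p, rfl⟩ : ∃ p, j = i + p := ⟨j - i, by omega⟩
  have hp : 0 < p := by omega
  change i + p < cm S + 1 at hj
  let g : ℕ → ℕ := fun n => if n < i then n else i + (n - i) % p
  have hg : ∀ n, g n < cm S := by
    intro n
    have := Nat.mod_lt (n - i) hp
    simp only [g]; split <;> omega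
  have hg1 : ∀ n, f (g n + 1) = f (g (n+1)) := by
    intro n
    simp only [g]
    by_cases h1 : n + 1 < i
    · rw [if_pos (by omega), if_pos h1]
    · rw [if_neg h1]
      by_cases h2 : n < i
      · rw [if_pos h2, show n + 1 - i = 0 by omega]; simp; congr 1; omega
      · rw [if_neg h2]
        obtain ⟨q, rfl⟩ : ∃ q, n = i + q := ⟨n - i, by omega⟩
        rw [show i + q - i = q by omega, show i + q + 1 - i = q + 1 by omega]
        have := Nat.mod_lt q hp
        by_cases h3 : q % p + 1 = p
        · rw [show i + q % p + 1 = i + p by omega, ← h]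
          have : (q + 1) % p = 0 := by
            rw [Nat.add_mod_eq_ite]
            have h1p : 1 % p + q % p = p ∨ p = 1 := by
              by_cases hp1 : p = 1
              · right; exact hp1
              · left; rw [Nat.mod_eq_of_lt (by omega)]; omega
            rcases h1p with h1p | h1p
            · rw [if_pos (by omega)]; omega
            · subst h1p; simp [Nat.mod_one]
          rw [this]; rfl
        · have : (q + 1) % p = q % p + 1 := by
            rw [Nat.add_mod, Nat.mod_eq_of_lt (a := 1) (by omega), Nat.mod_eq_of_lt (by omega)]
          rw [this]; rfl
  refine ⟨fun n => f (g n), fun n => κ (g n), ?_, ?_, ?_, ?_⟩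
  · rw [← hf0]; simp only [g]; congr 1; split
    · rfl
    · simp; omega
  · intro n
    have := (hf _ (hg n)).1
    rwa [hg1] at this
  · intro n hn
    obtain ⟨q, hq⟩ := dvd_La (S := S) (r := p) (by omega) (by omega)
    simp only [g]
    rw [if_neg (by omega), if_neg (by omega), hq, show n + p * q - i = (n - i) + p * q by omega,
      Nat.add_mul_mod_self_left]
  · intro hk n
    have := (hf _ (hg n)).2
    show κ (g n) = 0
    omega


theorem exit {x y s t k} (h : UPass M x y s t k) {n} (h1 : 1 ≤ n) (h2 : n ≤ k) :
    (∀ T V, Run M s (x :: T) (rp n y ++ V) t T V) ∨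
      ∃ s', ∀ T V, Run M s (x :: T) (rp n y ++ V) s' (x :: T) V := by
  induction h generalizing n with
  | @move s t d h =>
    cases d
    · simp at h2; omega
    · obtain rfl : n = 1 := by simp at h2; omega
      left
      intro T V
      exact .step (by simpa using h) (.refl _ _ _)
  | @stay s s1 t d k h _ ih =>
    cases d
    · rcases ih h1 (by simpa using h2) with h3 | ⟨s', h3⟩
      · left; intro T V
        exact .step (by rw [rep_head _ _ _ _ (by omega)]; simpa using h) (h3 T V)
      · right; refine ⟨s', fun T V => ?_⟩
        exact .step (by rw [rep_head _ _ _ _ (by omega)]; simpa using h) (h3 T V)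
    · obtain ⟨n, rfl⟩ : ∃ n', n = n' + 1 := ⟨n - 1, by omega⟩
      have hs : ∀ T V, Run M s (x :: T) (rp (n+1) y ++ V) s1 (x :: T) (rp n y ++ V) := by
        intro T V
        refine .step (d1 := false) (d2 := true) (t := s1) ?_ ?_
        · simpa [rp_succ] using h
        · exact .refl _ _ _
      by_cases hn : n = 0
      · subst hn; right; exact ⟨s1, hs⟩
      · rcases ih (n := n) (by omega) (by simpa using h2) with h3 | ⟨s', h3⟩
        · left; intro T V; exact (hs T V).trans (h3 T V)
        · right; exact ⟨s', fun T V => (hs T V).trans (h3 T V)⟩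


theorem start {y s Z n} (hn : 1 ≤ n) (h : ¬ ∃ t k, UWalk M y s Z t k ∧ k < n) :
    Dead M s Z (rp n y) ∨ ∃ s' Z', Z' <:+ Z ∧
      ∀ T V, Run M s (Z ++ T) (rp n y ++ V) s' (Z' ++ T) V := by
  induction Z generalizing s n with
  | nil => exact (h ⟨s, 0, .nil _, hn⟩).elim
  | cons x Z ih =>
    by_cases hp : ∃ t k, UPass M x y s t k
    · obtain ⟨t, k, hp⟩ := hp
      by_cases hk : k < n
      · have := ih (s := t) (n := n - k) (by omega) (by
          rintro ⟨t', k', h1, h2⟩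
          exact h ⟨t', _, .cons hp h1, by omega⟩)
        rcases this with h1 | ⟨s', Z', h1, h2⟩
        · left; exact Dead.of_run (fun T V => hp.run hk (Z ++ T) V) h1
        · right; exact ⟨s', Z', h1.trans (List.suffix_cons x Z),
            fun T V => (hp.run hk (Z ++ T) V).trans (h2 T V)⟩
      · right
        rcases exit hp hn (by omega) with h1 | ⟨s', h1⟩
        · exact ⟨t, Z, List.suffix_cons x Z, fun T V => h1 _ _⟩
        · exact ⟨s', x :: Z, List.suffix_rfl, fun T V => h1 _ _⟩
    · rcases phase hp n with ⟨s', h1, -⟩ | h1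
      · right; exact ⟨s', x :: Z, List.suffix_rfl, fun T V => h1.run_sw _ _⟩
      · left; exact h1.monoL Z

theorem sync (hI : M.Inj) {B} (hB : ∀ x y s t k, UPass M x y s t k → k ≤ B) {y s Z}
    (h : ¬ ∃ t k, UWalk M y s Z t k) {n j} (hn : B * Z.length + cm S < n) (T V) :
    Acc M s (Z ++ T) (rp (n + j * La S) y ++ V) ↔ Acc M s (Z ++ T) (rp n y ++ V) := by
  induction Z generalizing s n with
  | nil => exact (h ⟨s, 0, .nil _⟩).elim
  | cons x Z ih =>
    simp only [List.length_cons, mul_add, mul_one] at hn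
    by_cases hp : ∃ t k, UPass M x y s t k
    · obtain ⟨t, k, hp⟩ := hp
      have hk := hB _ _ _ _ _ hp
      simp only [List.cons_append]
      rw [(hp.run (n := n) (by omega) _ _).acc, (hp.run (n := n + j * La S) (by omega) _ _).acc,
        show n + j * La S - k = (n - k) + j * La S by omega]
      apply ih _ (by omega)
      rintro ⟨t', k', h1⟩
      exact h ⟨t', _, .cons hp h1⟩
    · rcases phase hp (cm S + 1) with ⟨s', h1, -⟩ | h1
      · obtain ⟨t1, k1, e, h2, h3, h4⟩ := block (Inj.sw hI) h1
        obtain ⟨rfl, rfl⟩ := h4 rfl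
        have r1 := block_q h2 h3 j
        rw [mul_zero, zero_add] at r1
        have r1 := r1.run_sw (Z ++ T) (rp (n - 1) y ++ V)
        have r2 := h2.walk.run_sw (Z ++ T) (rp (n - 1) y ++ V)
        rw [← List.append_assoc, ← rp_add, show 1 + j * La S + (n - 1) = n + j * La S by omega] at r1
        rw [show [y] = rp 1 y from rfl, ← List.append_assoc, ← rp_add, show 1 + (n - 1) = n by omega] at r2
        simp only [List.cons_append]
        rw [r1.acc, r2.acc]
      · obtain ⟨n', rfl⟩ : ∃ n', n = (cm S + 1) + n' := ⟨n - (cm S + 1), by omega⟩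
        rw [add_assoc, rp_add, rp_add (cm S + 1) n']
        simp only [List.append_assoc, List.cons_append]
        exact h1 _ _ _ _

end fin
end WKP

set_option linter.unusedSectionVars false
namespace WKP
variable {S : Type} {M : Mc S}

abbrev sa : Sy := Sum.inl false
abbrev sb : Sy := Sum.inl true

def IsL (W : List Sy) : Prop := ∀ z ∈ W, ∃ c : Bool, z = Sum.inl c

theorem IsL.app {W W'} (h : IsL W) (h' : IsL W') : IsL (W ++ W') := by
  intro z hz
  rcases List.mem_append.1 hz with h1 | h1
  · exact h z h1
  · exact h' z h1
theorem IsL.left {W W'} (h : IsL (W ++ W')) : IsL W := fun z hz => h z (by simp [hz])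
theorem IsL.right {W W'} (h : IsL (W ++ W')) : IsL W' := fun z hz => h z (by simp [hz])
theorem IsL.rev {W} (h : IsL W) : IsL W.reverse := fun z hz => h z (by simpa using hz)
theorem IsL.rp {n : ℕ} {c : Bool} : IsL (rp n (Sum.inl c)) :=
  fun z hz => ⟨c, (List.eq_of_mem_replicate hz)⟩
theorem IsL.nil : IsL [] := by intro z hz; simp at hz
theorem IsL.pw {Z c} (h : IsL Z) : IsL (pw Z c) := by
  induction c with
  | zero => exact IsL.nil
  | succ c ih => rw [pw_succ]; exact h.app ih

theorem locality {s0 P1 P2 s x R1 y R2} {Q1 Q2} (h : Run M s0 P1 P2 s Q1 Q2)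
    (e1 : Q1 = x :: R1) (e2 : Q2 = y :: R2) :
    ∃ u v, P1 = u ++ x :: R1 ∧ P2 = v ++ y :: R2 ∧
      ∀ R1' R2', Run M s0 (u ++ x :: R1') (v ++ y :: R2') s (x :: R1') (y :: R2') := by
  induction h with
  | refl => exact ⟨[], [], e1, e2, fun _ _ => .refl _ _ _⟩
  | @step s P1 P2 t d1 d2 s' Q1 Q2 h1 _ ih =>
    obtain ⟨u, v, hu, hv, ih2⟩ := ih e1 e2
    have aux : ∀ (d : Bool) (P : List Sy) (e : Sy) (u : List Sy) (x R1),
        mv d P = u ++ x :: R1 → ∃ u', P = u' ++ x :: R1 ∧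
          ∀ R1', (u' ++ x :: R1').headD e = P.headD e ∧ mv d (u' ++ x :: R1') = u ++ x :: R1' := by
      intro d P e u x R1 h
      cases d
      · simp at h
        subst h
        exact ⟨u, rfl, fun R1' => ⟨by cases u <;> simp, by simp⟩⟩
      · cases P with
        | nil => simp at h
        | cons p P =>
          simp at h
          subst h
          exact ⟨p :: u, by simp, fun R1' => ⟨by simp, by simp⟩⟩
    obtain ⟨u', rfl, hu'⟩ := aux d1 P1 M.e1 _ _ _ hu
    obtain ⟨v', rfl, hv'⟩ := aux d2 P2 M.e2 _ _ _ hv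
    refine ⟨u', v', rfl, rfl, fun R1' R2' => ?_⟩
    refine .step (d1 := d1) (d2 := d2) (t := t) ?_ ?_
    · rw [(hu' R1').1, (hv' R2').1]; exact h1
    · rw [(hu' R1').2, (hv' R2').2]; exact ih2 _ _

def Rch (M : Mc S) (x y : Sy) (s : S) : Prop := ∃ W1 W2 R1 R2, IsL W1 ∧ IsL W2 ∧
  Run M M.s0 (M.l :: W1) (M.r :: W2) s (x :: R1) (y :: R2)

theorem cons_split {u x R r W} (h : r :: W = u ++ x :: R) (hW : IsL W) :
    ∃ u0, u ++ [x] = r :: u0 ∧ IsL u0 ∧ ((∃ c, x = Sum.inl c) ∨ (x = r ∧ u0 = [])) := by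
  cases u with
  | nil =>
    simp at h
    exact ⟨[], by simp [h.1], IsL.nil, .inr ⟨h.1.symm, rfl⟩⟩
  | cons p u =>
    simp at h
    obtain ⟨rfl, rfl⟩ := h
    refine ⟨u ++ [x], by simp, ?_, .inl (hW x (by simp))⟩
    intro z hz
    exact hW z (by simp at hz ⊢; tauto)

theorem Rch.loc {x y s} (h : Rch M x y s) : ∃ u0 v0, IsL u0 ∧ IsL v0 ∧
    ((∃ c, x = Sum.inl c) ∨ (x = M.l ∧ u0 = [])) ∧
    ((∃ c, y = Sum.inl c) ∨ (y = M.r ∧ v0 = [])) ∧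
    ∀ R1 R2, Run M M.s0 (M.l :: u0 ++ R1) (M.r :: v0 ++ R2) s (x :: R1) (y :: R2) := by
  obtain ⟨W1, W2, R1, R2, h1, h2, hr⟩ := h
  obtain ⟨u, v, hu, hv, hr⟩ := locality hr rfl rfl
  obtain ⟨u0, hu0, hu1, hu2⟩ := cons_split hu h1
  obtain ⟨v0, hv0, hv1, hv2⟩ := cons_split hv h2
  refine ⟨u0, v0, hu1, hv1, hu2, hv2, fun R1' R2' => ?_⟩
  rw [← hu0, ← hv0]
  simpa using hr R1' R2'

theorem Rch.run {x y s x' y' s' R1 R2 R1' R2'} (h : Rch M x y s) (h1 : IsL R1) (h2 : IsL R2)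
    (hr : Run M s (x :: R1) (y :: R2) s' (x' :: R1') (y' :: R2')) : Rch M x' y' s' := by
  obtain ⟨u0, v0, hu, hv, -, -, hr0⟩ := h.loc
  exact ⟨u0 ++ R1, v0 ++ R2, _, _, hu.app h1, hv.app h2, (hr0 R1 R2).trans hr⟩

theorem Rch.sw {x y s} (h : Rch M x y s) : Rch M.sw y x s := by
  obtain ⟨W1, W2, R1, R2, h1, h2, hr⟩ := h
  exact ⟨W2, W1, R2, R1, h2, h1, hr.sw⟩

theorem Rch.start : Rch M M.l M.r M.s0 := ⟨[], [], [], [], IsL.nil, IsL.nil, .refl _ _ _⟩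

theorem consume1_aux {x s} {R1 R : List Sy} (h : Acc M s R1 R)
    (hn : ¬ ∃ t R', R' <:+ R ∧ ∀ T, Run M s (x :: T) R t T R') (T T')
    (e1 : R1 = x :: T) : Acc M s (x :: T') R := by
  induction h with
  | halt h3 h4 => subst e1; exact .halt h3 h4
  | @step s R1 R2 t d1 d2 h3 h4 ih =>
    subst e1
    have hmv : mv d2 R2 <:+ R2 := by
      cases d2
      · exact List.suffix_rfl
      · exact List.tail_suffix _
    cases d1
    · refine .step h3 (ih ?_ rfl)
      rintro ⟨t', R', h5, h6⟩
      exact hn ⟨t', R', h5.trans hmv, fun T => .step h3 (h6 T)⟩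
    · exact (hn ⟨t, mv d2 R2, hmv, fun T => .step h3 (.refl _ _ _)⟩).elim

theorem consume (s : S) (Z R : List Sy) :
    IndT M s Z R ∨ ∃ t R', R' <:+ R ∧ ∀ T, Run M s (Z ++ T) R t T R' := by
  induction Z generalizing s R with
  | nil => right; exact ⟨s, R, List.suffix_rfl, fun T => .refl _ _ _⟩
  | cons x Z ih =>
    by_cases h : ∃ t R', R' <:+ R ∧ ∀ T, Run M s (x :: T) R t T R'
    · obtain ⟨t, R', h1, h2⟩ := h
      rcases ih t R' with h3 | ⟨t2, R2, h3, h4⟩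
      · left; exact IndT.of_run (fun T => h2 (Z ++ T)) h3
      · right; exact ⟨t2, R2, h3.trans h1, fun T => (h2 (Z ++ T)).trans (h4 T)⟩
    · left
      intro T T'
      exact ⟨fun h' => consume1_aux h' h _ _ rfl, fun h' => consume1_aux h' h _ _ rfl⟩

theorem empty_aux {x s} {R1 R : List Sy} (h : Acc M s R1 R)
    (hn : ¬ ∃ t k, UPass M x M.e2 s t k) (T T')
    (e1 : R1 = x :: T) (e2 : R = []) : Acc M s (x :: T') R := by
  induction h with
  | halt h3 h4 => subst e1; exact .halt h3 h4
  | @step s R1 R2 t d1 d2 h3 h4 ih =>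
    subst e1 e2
    cases d1
    · refine .step h3 (ih ?_ rfl (by cases d2 <;> rfl))
      rintro ⟨t', k, h5⟩
      exact hn ⟨t', _, .stay h3 h5⟩
    · exact (hn ⟨_, _, .move h3⟩).elim

theorem empty_const (s : S) (Z : List Sy) :
    (∃ t k, UWalk M M.e2 s Z t k) ∨ IndT M s Z [] := by
  induction Z generalizing s with
  | nil => left; exact ⟨s, 0, .nil _⟩
  | cons x Z ih =>
    by_cases h : ∃ t k, UPass M x M.e2 s t k
    · obtain ⟨t, k, h⟩ := h
      rcases ih t with ⟨t', k', h1⟩ | h1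
      · left; exact ⟨_, _, .cons h h1⟩
      · right; exact IndT.of_run (fun T => h.run_nil (Z ++ T)) h1
    · right
      intro T T'
      exact ⟨fun h' => empty_aux h' h _ _ rfl rfl, fun h' => empty_aux h' h _ _ rfl rfl⟩

section fin
variable [Fintype S]

variable (S) in
def bl (ks : List ℕ) : List Sy := ks.flatMap (fun k => rp k sb ++ rp (nn S) sa)

theorem bl_append (ks ks') : bl S (ks ++ ks') = bl S ks ++ bl S ks' := by simp [bl]
theorem bl_cons (k ks) : bl S (k :: ks) = rp k sb ++ rp (nn S) sa ++ bl S ks := by simp [bl]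
theorem bl_nil : bl S [] = [] := rfl

variable (S) in
def rho : List Sy := rp (nn S) sb ++ rp (nn S) sa

theorem rho_L : IsL (rho S) := IsL.rp.app IsL.rp
theorem bl_L (ks) : IsL (bl S ks) := by
  induction ks with
  | nil => exact IsL.nil
  | cons k ks ih => rw [bl_cons]; exact (IsL.rp.app IsL.rp).app ih

theorem bl_rep (c) : bl S (List.replicate c (nn S)) = pw (rho S) c := by
  induction c with
  | zero => rfl
  | succ c ih => rw [List.replicate_succ, bl_cons, ih, pw_succ, rho]

theorem bl_rev_aux (k ks k') :
    rp k sb ++ (ks ++ [k']).flatMap (fun k => rp (nn S) sa ++ rp k sb) =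
      bl S (k :: ks) ++ rp k' sb := by
  induction ks generalizing k with
  | nil => simp [bl]
  | cons k2 ks ih =>
    rw [bl_cons, List.append_assoc, ← ih]
    simp

theorem bl_rev (k' ks k) : (bl S (k' :: ks) ++ rp k sb).reverse =
    bl S (k :: ks.reverse) ++ rp k' sb := by
  rw [← bl_rev_aux]
  simp [bl, List.reverse_flatMap, List.flatMap_append, Function.comp_def]

variable (S) in
def oz (i c n1 n2 : ℕ) : List ℕ :=
  List.replicate i (nn S) ++ n1 :: (List.replicate (La S - 1) (nn S) ++ n2 :: List.replicate c (nn S))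

theorem oz_same (i c) : oz S i c (nn S) (nn S) = List.replicate (i + La S + 1 + c) (nn S) := by
  have := La_pos (S := S)
  simp only [oz, ← List.replicate_succ, List.replicate_append_replicate]
  congr 1; omega

theorem oz_shift (j i c n1 n2) : bl S (oz S (j + i) c n1 n2) = pw (rho S) j ++ bl S (oz S i c n1 n2) := by
  rw [← bl_rep, ← bl_append]
  congr 1
  simp [oz, ← List.replicate_append_replicate]

theorem oz_ext (j i c n1 n2) : bl S (oz S i (c + j) n1 n2) = bl S (oz S i c n1 n2) ++ pw (rho S) j := by
  rw [← bl_rep, ← bl_append]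
  congr 1
  simp [oz, ← List.replicate_append_replicate]

theorem oz_rev (i c n1 n2) : (bl S (oz S (i+1) c n1 n2) ++ rp (nn S) sb).reverse =
    bl S (oz S (c+1) i n2 n1) ++ rp (nn S) sb := by
  have : oz S (i+1) c n1 n2 = nn S :: oz S i c n1 n2 := by simp [oz, List.replicate_succ]
  rw [this, bl_rev]
  congr 2
  simp [oz, List.replicate_succ]

theorem pairwalk (hI : M.Inj) {y s t k} (h : UWalk M y s (pw (rho S) (cm S)) t k)
    {i c} (hi : cm S ≤ i) : ∃ t0 K e, (∀ q1 q2,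
      UWalk M y s (bl S (oz S i c (1 + q1 * La S) (1 + q2 * La S))) t0 (K + (q1+q2) * e)) ∧
      (k = 0 → K = 0 ∧ e = 0) := by
  obtain ⟨f, κ, hf0, hf, hper, hk0⟩ := evper h
  have hsite : ∃ t1 k1 e k2, (∀ q, UWalk M y (f i) (rp (1 + q * La S) sb) t1 (k1 + q * e)) ∧
      UWalk M y t1 (rp (nn S) sa) (f (i+1)) k2 ∧ (k = 0 → k1 = 0 ∧ e = 0 ∧ k2 = 0) := by
    have h1 := hf i
    unfold rho at h1
    obtain ⟨t1, k1, k2, h2, h3, h4⟩ := h1.split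
    obtain ⟨j, hj⟩ : ∃ j, nn S = (cm S + 1) + j := ⟨nn S - (cm S + 1), by have := cm_lt_nn (S := S); omega⟩
    have h2' := h2
    rw [hj, rp_add] at h2'
    obtain ⟨t', k1', k2', h5, h6, h7⟩ := h2'.split
    obtain ⟨t1', k1'', e, h8, h9, h10⟩ := block hI h5
    obtain ⟨rfl, h11⟩ := (block_q h8 h9 (La S)).det h2
    refine ⟨t1', k1'', e, k2, block_q h8 h9, h3, fun hk => ?_⟩
    have := hk0 hk i
    have := h10 (by omega)
    refine ⟨this.1, this.2, by omega⟩
  obtain ⟨t1, k1, e, k2, hs1, hs2, hs3⟩ := hsite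
  have w1 := UWalk.ofSeq f κ i (fun j _ => hf j)
  rw [hf0] at w1
  have w2 := UWalk.ofSeq (fun j => f (i + 1 + j)) (fun j => κ (i + 1 + j)) (La S - 1) (fun j _ => hf _)
  simp only [add_zero] at w2
  have hLa := La_pos (S := S)
  rw [show i + 1 + (La S - 1) = i + La S by omega, hper i hi] at w2
  have w3 := UWalk.ofSeq (fun j => f (i + 1 + j)) (fun j => κ (i + 1 + j)) c (fun j _ => hf _)
  simp only [add_zero] at w3
  generalize hK1 : ∑ j ∈ Finset.range i, κ j = K1 at w1
  generalize hK2 : ∑ j ∈ Finset.range (La S - 1), κ (i + 1 + j) = K2 at w2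
  generalize hK3 : ∑ j ∈ Finset.range c, κ (i + 1 + j) = K3 at w3
  refine ⟨f (i + 1 + c), K1 + K2 + K3 + 2 * k1 + 2 * k2, e, fun q1 q2 => ?_, fun hk => ?_⟩
  · have := w1.append ((hs1 q1).append (hs2.append (w2.append ((hs1 q2).append (hs2.append w3)))))
    have e1 : bl S (oz S i c (1 + q1 * La S) (1 + q2 * La S)) = pw (rho S) i ++
      (rp (1 + q1 * La S) sb ++ (rp (nn S) sa ++ (pw (rho S) (La S - 1) ++ (rp (1 + q2 * La S) sb
        ++ (rp (nn S) sa ++ pw (rho S) c))))) := by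
      simp only [oz, bl_append, bl_cons, bl_rep, List.append_assoc]
    rw [e1]
    convert this using 1
    ring
  · have := hs3 hk
    have z := hk0 hk
    simp only [z, Finset.sum_const_zero] at hK1 hK2 hK3
    omega

variable (S) in
def Wd : ℕ := cm S + La S + 1

theorem fc_tail {s R} (hd : IndT M s (pw (rho S) (Wd S)) R) {c} (hc : 2 * Wd S ≤ c) (n1 n2) :
    ∃ i c', cm S ≤ i ∧ i + La S + 1 + c' = c ∧ ∀ T,
      Acc M s (pw (rho S) c ++ T) R ↔ Acc M s (bl S (oz S i c' n1 n2) ++ T) R := by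
  unfold Wd at hc
  refine ⟨Wd S, c - Wd S - La S - 1, by unfold Wd; omega, by unfold Wd; omega, fun T => ?_⟩
  have := oz_shift (S := S) (Wd S) 0 (c - Wd S - La S - 1) n1 n2
  rw [add_zero] at this
  rw [this]
  obtain ⟨c, rfl⟩ : ∃ c', c = Wd S + c' := ⟨c - Wd S, by unfold Wd; omega⟩
  rw [pw_add]
  simp only [List.append_assoc]
  exact hd _ _

theorem fc_walk (hI : M.Inj) {y s R t k} (h : UWalk M y s (pw (rho S) (Wd S)) t k)
    (hr' : ∀ Z' Z'' , UWalk M y s Z' t k → UWalk M y s Z'' t k → ∀ T,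
      Acc M s (Z' ++ T) R ↔ Acc M s (Z'' ++ T) R)
    {c} (hc : 2 * Wd S ≤ c) {q1 q2} (hq : q1 + q2 = 2 * La S) :
    ∃ i c', cm S ≤ i ∧ i + La S + 1 + c' = c ∧ ∀ T,
      Acc M s (pw (rho S) c ++ T) R ↔
        Acc M s (bl S (oz S i c' (1 + q1 * La S) (1 + q2 * La S)) ++ T) R := by
  have h' := h
  rw [show Wd S = cm S + (La S + 1) by unfold Wd; omega, pw_add] at h'
  obtain ⟨t', k', _, h1, -, -⟩ := h'.split
  obtain ⟨t0, K, e, hw, -⟩ := pairwalk hI h1 (i := cm S) (c := 0) le_rfl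
  have w1 := hw (La S) (La S)
  have w2 := hw q1 q2
  rw [show oz S (cm S) 0 (1 + La S * La S) (1 + La S * La S) = _ from oz_same (cm S) 0, bl_rep] at w1
  change UWalk M y s (pw (rho S) (Wd S)) t0 _ at w1
  obtain ⟨rfl, hk⟩ := w1.det h
  rw [hq, show 2 * La S = La S + La S by omega, hk] at w2
  have hWc : Wd S ≤ c := by omega
  refine ⟨cm S, c - Wd S, le_rfl, by unfold Wd at *; omega, fun T => ?_⟩
  have := oz_ext (S := S) (c - Wd S) (cm S) 0 (1 + q1 * La S) (1 + q2 * La S)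
  rw [zero_add] at this
  rw [this]
  conv_lhs => rw [show c = Wd S + (c - Wd S) by omega, pw_add]
  simp only [List.append_assoc]
  exact hr' _ _ h w2 _

theorem fc_nil (hI : M.Inj) (s : S) {c} (hc : 2 * Wd S ≤ c) {q1 q2} (hq : q1 + q2 = 2 * La S) :
    ∃ i c', cm S ≤ i ∧ i + La S + 1 + c' = c ∧ ∀ T,
      Acc M s (pw (rho S) c ++ T) [] ↔
        Acc M s (bl S (oz S i c' (1 + q1 * La S) (1 + q2 * La S)) ++ T) [] := by
  rcases empty_const (M := M) s (pw (rho S) (Wd S)) with ⟨t, k, h⟩ | h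
  · refine fc_walk hI h (fun Z' Z'' h1 h2 T => ?_) hc hq
    rw [(h1.run_nil T).acc, (h2.run_nil T).acc]
  · exact fc_tail h hc _ _

theorem fc_pos (hI : M.Inj) (L : ℕ) {q1 q2} (hq : q1 + q2 = 2 * La S) :
    ∀ (s : S) (y j V) (c : ℕ), 1 ≤ j → V.length ≤ L → (L + 3) * Wd S ≤ c →
    ∃ i c', cm S ≤ i ∧ i + La S + 1 + c' = c ∧ ∀ T,
      Acc M s (pw (rho S) c ++ T) (rp j y ++ V) ↔
        Acc M s (bl S (oz S i c' (1 + q1 * La S) (1 + q2 * La S)) ++ T) (rp j y ++ V) := by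
  induction L with
  | zero =>
    intro s y j V c hj hV hc
    obtain rfl : V = [] := List.length_eq_zero_iff.1 (by omega)
    by_cases hw : ∃ t k, UWalk M y s (pw (rho S) (Wd S)) t k ∧ k < j
    · obtain ⟨t, k, hw, hk⟩ := hw
      refine fc_walk hI hw (fun Z' Z'' h1 h2 T => ?_)
        (by omega) hq
      rw [(h1.run hk T _).acc, (h2.run hk T _).acc]
    · rcases start hj hw with h | ⟨s', Z', hZ, hr⟩
      · exact fc_tail (h.indT []) (by omega) _ _
      · rcases consume (M := M) s' Z' [] with h | ⟨t2, R', h1, h2⟩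
        · exact fc_tail (IndT.of_run (fun T => hr T []) h) (by omega) _ _
        · obtain rfl : R' = [] := by simpa using h1
          obtain ⟨i, c', hi, hc', h3⟩ := fc_nil hI t2 (c := c - Wd S) (by omega) hq
          refine ⟨Wd S + i, c', by omega, by omega, fun T => ?_⟩
          rw [oz_shift]
          conv_lhs => rw [show c = Wd S + (c - Wd S) by omega, pw_add]
          simp only [List.append_assoc]
          have rr := fun T => (hr T []).trans (h2 T)
          rw [(rr _).acc, (rr _).acc]
          exact h3 T
  | succ L ih =>
    intro s y j V c hj hV hc
    have hc2 : (L + 3) * Wd S + Wd S ≤ c := by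
      calc _ = (L + 1 + 3) * Wd S := by ring
        _ ≤ c := hc
    have hc3 : 3 * Wd S ≤ (L + 3) * Wd S := Nat.mul_le_mul_right _ (by omega)
    by_cases hw : ∃ t k, UWalk M y s (pw (rho S) (Wd S)) t k ∧ k < j
    · obtain ⟨t, k, hw, hk⟩ := hw
      refine fc_walk hI hw (fun Z' Z'' h1 h2 T => ?_)
        (by omega) hq
      rw [(h1.run hk T _).acc, (h2.run hk T _).acc]
    · rcases start hj hw with h | ⟨s', Z', hZ, hr⟩
      · exact fc_tail (h.indT V) (by omega) _ _
      · rcases consume (M := M) s' Z' V with h | ⟨t2, R', h1, h2⟩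
        · exact fc_tail (IndT.of_run (fun T => hr T V) h) (by omega) _ _
        · have key : ∃ i c', cm S ≤ i ∧ i + La S + 1 + c' = c - Wd S ∧ ∀ T,
              Acc M t2 (pw (rho S) (c - Wd S) ++ T) R' ↔
              Acc M t2 (bl S (oz S i c' (1 + q1 * La S) (1 + q2 * La S)) ++ T) R' := by
            cases R' with
            | nil => exact fc_nil hI t2 (c := c - Wd S) (by omega) hq
            | cons y' V' =>
              have := h1.length_le
              simp at this
              exact ih t2 y' 1 V' (c - Wd S) le_rfl (by omega) (by omega)
          obtain ⟨i, c', hi, hc', h3⟩ := key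
          refine ⟨Wd S + i, c', by omega, by omega, fun T => ?_⟩
          rw [oz_shift]
          conv_lhs => rw [show c = Wd S + (c - Wd S) by omega, pw_add]
          simp only [List.append_assoc]
          have rr := fun T => (hr T V).trans (h2 T)
          rw [(rr _).acc, (rr _).acc]
          exact h3 T

theorem fc (hI : M.Inj) (L : ℕ) {q1 q2} (hq : q1 + q2 = 2 * La S) (s : S) (y j V) (c : ℕ)
    (hV : V.length ≤ L) (hc : (L + 3) * Wd S ≤ c) :
    ∃ i c', cm S ≤ i ∧ i + La S + 1 + c' = c ∧ ∀ T,
      Acc M s (pw (rho S) c ++ T) (rp j y ++ V) ↔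
        Acc M s (bl S (oz S i c' (1 + q1 * La S) (1 + q2 * La S)) ++ T) (rp j y ++ V) := by
  cases j with
  | succ j => exact fc_pos hI L hq s y (j+1) V c (by omega) hV hc
  | zero =>
    cases V with
    | nil =>
      have hc3 : 3 * Wd S ≤ (L + 3) * Wd S := Nat.mul_le_mul_right _ (by omega)
      exact fc_nil hI s (by omega) hq
    | cons y' V' =>
      simp at hV
      exact fc_pos hI L hq s y' 1 V' c (by omega) (by omega) hc

end fin
end WKP

set_option linter.unusedSectionVars false
namespace WKP
variable {S : Type} {M : Mc S}

def Rec (M : Mc S) (Q : List Sy → Prop) : Prop :=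
  ∀ W, IsL W → (Acc M M.s0 (M.l :: W) (M.r :: W.reverse) ↔ Q W)

def Tog (Q : List Sy → Prop) : Prop :=
  ∀ α β k, 2 ≤ k → (Q (α ++ sa :: sb :: sa :: β) ↔ ¬ Q (α ++ sa :: (rp k sb ++ sa :: β)))

theorem Rec.sw {Q} (h : Rec M Q) : Rec M.sw (fun W => Q W.reverse) := by
  intro W hW
  have := h W.reverse hW.rev
  rw [List.reverse_reverse] at this
  show _ ↔ Q W.reverse
  rw [← this]
  exact Acc_sw

theorem Tog.rev {Q} (h : Tog Q) : Tog (fun W => Q W.reverse) := by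
  intro α β k hk
  have := h β.reverse α.reverse k hk
  simpa [List.append_assoc] using this

section fin
variable [Fintype S]

theorem nn_pos : 1 ≤ nn S := by unfold nn; omega
theorem nn_two : 2 ≤ nn S := by
  have := Nat.mul_pos (La_pos (S := S)) (La_pos (S := S)); unfold nn; omega

theorem tog_bl {Q} (h : Tog Q) {ks ks' : List ℕ} (hks : ks ≠ []) {k} (hk : 2 ≤ k) (α β) :
    Q (α ++ bl S (ks ++ 1 :: ks') ++ β) ↔ ¬ Q (α ++ bl S (ks ++ k :: ks') ++ β) := by
  rcases List.eq_nil_or_concat ks with rfl | ⟨ks, k0, rfl⟩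
  · exact (hks rfl).elim
  · obtain ⟨p, hp⟩ : ∃ p, nn S = p + 1 := ⟨nn S - 1, by have := nn_pos (S := S); omega⟩
    have := h (α ++ bl S ks ++ rp k0 sb ++ rp p sa) (rp p sa ++ bl S ks' ++ β) k hk
    have e1 : rp (nn S) sa = rp p sa ++ [sa] := by rw [hp, rp_add]; rfl
    have e2 : rp (nn S) sa = sa :: rp p sa := by rw [hp, rp_succ]
    have key : ∀ j, α ++ bl S (ks ++ [k0] ++ j :: ks') ++ β =
        (α ++ bl S ks ++ rp k0 sb ++ rp p sa) ++ sa :: (rp j sb ++ sa :: (rp p sa ++ bl S ks' ++ β)) := by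
      intro j
      rw [bl_append, bl_append, bl_cons, bl_cons, bl_nil]
      conv_lhs => 
        enter [1, 2, 1, 2]
        rw [e1]
      conv_lhs => 
        enter [1, 2, 2]
        rw [e2]
      simp
    rw [List.concat_eq_append, key, key]
    exact this

theorem tog_bl2 {Q} (h : Tog Q) {ks ks' : List ℕ} (hks : ks ≠ []) {k k'} (hk : 2 ≤ k) (hk' : 2 ≤ k') (α β) :
    Q (α ++ bl S (ks ++ k :: ks') ++ β) ↔ Q (α ++ bl S (ks ++ k' :: ks') ++ β) := by
  have h1 := tog_bl (S := S) h hks (ks' := ks') hk α β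
  have h2 := tog_bl (S := S) h hks (ks' := ks') hk' α β
  tauto

theorem tog_oz {Q} (h : Tog Q) {i c k} (hi : 1 ≤ i) (hk : 2 ≤ k) (α β) :
    Q (α ++ bl S (oz S i c 1 k) ++ β) ↔ ¬ Q (α ++ pw (rho S) (i + La S + 1 + c) ++ β) := by
  have e : pw (rho S) (i + La S + 1 + c) = bl S (oz S i c (nn S) (nn S)) := by
    rw [oz_same, bl_rep]
  rw [e]
  unfold oz
  have hne : List.replicate i (nn S) ≠ [] := by simp; omega
  rw [tog_bl (S := S) h hne (nn_two (S := S))]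
  have e2 : ∀ j, List.replicate i (nn S) ++ nn S :: (List.replicate (La S - 1) (nn S) ++ j :: List.replicate c (nn S))
    = (List.replicate i (nn S) ++ nn S :: List.replicate (La S - 1) (nn S)) ++ j :: List.replicate c (nn S) := by
    intro j; simp
  rw [e2, e2, tog_bl2 (S := S) h (by simp) hk (nn_two (S := S))]

def ScenI (M : Mc S) : Prop := ∃ x y s pre t k, Rch M x y s ∧ IsL pre ∧
  UWalk M y s (x :: pre ++ pw (rho S) (cm S)) t k ∧ ((∃ c, y = Sum.inl c) ∨ k = 0)

theorem suffix_rp {R' : List Sy} {K y V} (h : R' <:+ rp K y ++ V) :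
    ∃ j V', R' = rp j y ++ V' ∧ V'.length ≤ V.length := by
  obtain ⟨P, hP⟩ := h
  rcases List.append_eq_append_iff.1 hP with ⟨a, ha, hb⟩ | ⟨a, ha, hb⟩
  · have := (List.append_eq_replicate_iff.1 ha.symm).2.2
    exact ⟨a.length, V, by rw [hb]; congr 1, le_rfl⟩
  · refine ⟨0, R', by simp, ?_⟩
    rw [hb]; simp

theorem baseX (hI : M.Inj) {y s t k} (h : UWalk M y s (pw (rho S) (cm S)) t k) (c : ℕ) :
    ∃ tX kX, UWalk M y s (pw (rho S) c ++ rp (nn S) sb) tX kX ∧ (k = 0 → kX = 0) ∧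
      ∀ i c', cm S ≤ i → i + La S + 1 + c' = c →
        UWalk M y s (bl S (oz S i c' 1 (1 + 2 * La S * La S)) ++ rp (nn S) sb) tX kX := by
  obtain ⟨f, κ, hf0, hf, hper, hk0⟩ := evper h
  have w1 := UWalk.ofSeq f κ c (fun j _ => hf j)
  rw [hf0] at w1
  have w2 := hf c
  unfold rho at w2
  obtain ⟨tX, k1, k2, w2, -, hk⟩ := w2.split
  refine ⟨tX, _, w1.append w2, fun hk1 => ?_, ?_⟩
  · have z := hk0 hk1
    simp only [z, Finset.sum_const_zero]
    have := z c
    omega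
  · intro i c' hi hc
    obtain ⟨t0, K, e, hw, -⟩ := pairwalk hI h hi (c := c')
    have h1 := hw (La S) (La S)
    rw [show oz S i c' (1 + La S * La S) (1 + La S * La S) = _ from oz_same i c', bl_rep, hc] at h1
    obtain ⟨rfl, h2⟩ := h1.det w1
    have h3 := hw 0 (2 * La S)
    rw [show 0 + 2 * La S = La S + La S by omega, h2, zero_mul, add_zero] at h3
    exact h3.append w2

theorem scenI_false (hI : M.Inj) {Q} (hQ : Rec M Q) (hT : Tog Q) (h : ScenI M) : False := by
  obtain ⟨x, y, s, pre, t, k, hR, hpre, hw, hyk⟩ := h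
  obtain ⟨u0, v0, hu0, hv0, -, -, hrun⟩ := hR.loc
  obtain ⟨s1, k1, k2, hw1, hw2, rfl⟩ := hw.split
  have hm : 1 ≤ cm S := Fintype.card_pos_iff.2 ⟨s⟩
  generalize hc0 : (v0.length + 3) * Wd S = c0
  obtain ⟨tX, kX, hX, hX0, hXp⟩ := baseX hI hw2 (c0 + cm S)
  have hK : IsL (rp (k1 + kX) y) := by
    rcases hyk with ⟨c, rfl⟩ | hk
    · exact IsL.rp
    · rw [hX0 (by omega), show k1 = 0 by omega]; exact IsL.nil
  have key : ∀ X', IsL X' → UWalk M y s1 X' tX kX →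
      (Q (u0 ++ pre ++ X' ++ (rp (k1 + kX) y ++ v0.reverse)) ↔
        Acc M.sw tX ([y] ++ (X'.reverse ++ (pre.reverse ++ u0.reverse))) (rp (k1 + kX) y ++ v0.reverse)) := by
    intro X' hL hU
    rw [← hQ _ (((hu0.app hpre).app hL).app (hK.app hv0.rev)), Acc_sw]
    have r1 := hrun (pre ++ X' ++ (rp (k1 + kX) y ++ v0.reverse))
      (rp (k1 + kX) y ++ (X'.reverse ++ (pre.reverse ++ u0.reverse)))
    have r2 := (hw1.append hU).run (n := k1 + kX + 1) (by omega) (rp (k1 + kX) y ++ v0.reverse)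
      (X'.reverse ++ (pre.reverse ++ u0.reverse))
    rw [show k1 + kX + 1 - (k1 + kX) = 1 by omega, rp_succ (k1 + kX)] at r2
    have := (r1.trans (by simpa using r2)).acc
    simpa using this
  have kb := key _ ((rho_L.pw).app IsL.rp) hX
  have kp := fun i c' (hi : cm S ≤ i) (hc : i + La S + 1 + c' = c0 + cm S) =>
    key _ ((bl_L _).app IsL.rp) (hXp i c' hi hc)
  have hbad : ∀ i c', cm S ≤ i → i + La S + 1 + c' = c0 + cm S →
      (Q (u0 ++ pre ++ (bl S (oz S i c' 1 (1 + 2 * La S * La S)) ++ rp (nn S) sb) ++ (rp (k1 + kX) y ++ v0.reverse)) ↔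
      Q (u0 ++ pre ++ (pw (rho S) (c0 + cm S) ++ rp (nn S) sb) ++ (rp (k1 + kX) y ++ v0.reverse))) → False := by
    intro i c' hi hc hh
    have hk2 : 2 ≤ 1 + 2 * La S * La S := by
      have := Nat.mul_pos (Nat.mul_pos (show 0 < 2 by norm_num) (La_pos (S := S))) (La_pos (S := S)); omega
    have := tog_oz (S := S) hT (i := i) (c := c') (by omega) hk2 (u0 ++ pre)
      (rp (nn S) sb ++ (rp (k1 + kX) y ++ v0.reverse))
    rw [hc] at this
    simp only [List.append_assoc] at this hh
    tauto
  have hWc : 3 * Wd S ≤ c0 := by rw [← hc0]; exact Nat.mul_le_mul_right _ (by omega)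
  rcases consume (M := M.sw) tX [y] (rp (k1 + kX) y ++ v0.reverse) with hd | ⟨t2, R', hR', hr⟩
  · have hW : Wd S = cm S + La S + 1 := rfl
    refine hbad (cm S) (c0 - La S - 1) le_rfl (by omega) ?_
    rw [kb, kp (cm S) (c0 - La S - 1) le_rfl (by omega)]
    exact hd _ _
  · obtain ⟨j, V', rfl, hV'⟩ := suffix_rp hR'
    obtain ⟨i, c', hi, hc, hacc⟩ := fc (M := M.sw) (Inj.sw hI) v0.length (q1 := 2 * La S) (q2 := 0) (by omega)
      t2 y j V' c0 (by simpa using hV') hc0.le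
    obtain ⟨i, rfl⟩ : ∃ i', i = i' + 1 := ⟨i - 1, by omega⟩
    refine hbad (c' + cm S + 1) i (by omega) (by omega) ?_
    rw [kb, kp (c' + cm S + 1) i (by omega) (by omega), (hr _).acc, (hr _).acc]
    have e1 : (bl S (oz S (c' + cm S + 1) i 1 (1 + 2 * La S * La S)) ++ rp (nn S) sb).reverse
      = bl S (oz S (i+1) c' (1 + 2 * La S * La S) 1) ++ (pw (rho S) (cm S) ++ rp (nn S) sb) := by
      rw [oz_rev, oz_ext, List.append_assoc]
    have e2 : (pw (rho S) (c0 + cm S) ++ rp (nn S) sb).reverse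
      = pw (rho S) c0 ++ (pw (rho S) (cm S) ++ rp (nn S) sb) := by
      obtain ⟨c1, hc1⟩ : ∃ c1, c0 + cm S = c1 + 1 := ⟨c0 + cm S - 1, by omega⟩
      rw [← List.append_assoc, ← pw_add, hc1, ← bl_rep, List.replicate_succ, bl_rev]
      simp
    rw [e1, e2]
    have := hacc (pw (rho S) (cm S) ++ rp (nn S) sb ++ (pre.reverse ++ u0.reverse))
    rw [zero_mul, add_zero] at this
    simp only [List.append_assoc] at this ⊢
    exact this.symm

end fin
end WKP

set_option linter.unusedSectionVars false
namespace WKP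
variable {S : Type} {M : Mc S}

def Blk (N : ℕ) (L : List Sy) : List Sy := L.flatMap (fun y => rp N y)

theorem Blk_nil (N) : Blk N [] = [] := rfl
theorem Blk_cons (N y L) : Blk N (y :: L) = rp N y ++ Blk N L := by simp [Blk]
theorem Blk_append (N L L') : Blk N (L ++ L') = Blk N L ++ Blk N L' := by simp [Blk]
theorem Blk_pw (N Z c) : Blk N (pw Z c) = pw (Blk N Z) c := by
  induction c with
  | zero => rfl
  | succ c ih => rw [pw_succ, pw_succ, Blk_append, ih]
theorem Blk_rev (N L) : (Blk N L).reverse = Blk N L.reverse := by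
  induction L with
  | nil => rfl
  | cons y L ih => rw [Blk_cons, List.reverse_append, ih, List.reverse_cons, Blk_append, Blk_cons, Blk_nil]; simp
theorem Blk_L {N L} (h : IsL L) : IsL (Blk N L) := by
  intro z hz
  simp only [Blk, List.mem_flatMap] at hz
  obtain ⟨y, hy, hz⟩ := hz
  rw [List.eq_of_mem_replicate hz]
  exact h y hy

theorem IsL.suf {W W'} (h : IsL W) (h' : W' <:+ W) : IsL W' := fun z hz => h z (h'.subset hz)
theorem IsL.one {c : Bool} : IsL [Sum.inl c] := IsL.rp (n := 1)
theorem IsL.cons {y W} (h : ∃ c, y = Sum.inl c) (h' : IsL W) : IsL (y :: W) := by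
  intro z hz
  rcases List.mem_cons.1 hz with rfl | hz
  · exact h
  · exact h' z hz

/-- reachability of full configurations -/
def HR (M : Mc S) (s : S) (R1 R2 : List Sy) : Prop := ∃ W1 W2, IsL W1 ∧ IsL W2 ∧
  Run M M.s0 (M.l :: W1) (M.r :: W2) s R1 R2

def InvT (M : Mc S) (s : S) (Z R : List Sy) : Prop := ∀ T, IsL T → HR M s (Z ++ T) R

theorem HR.sw {s R1 R2} (h : HR M s R1 R2) : HR M.sw s R2 R1 := by
  obtain ⟨W1, W2, h1, h2, h3⟩ := h
  exact ⟨W2, W1, h2, h1, h3.sw⟩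

theorem HR.run {s R1 R2 t R1' R2'} (h : HR M s R1 R2) (hr : Run M s R1 R2 t R1' R2') :
    HR M t R1' R2' := by
  obtain ⟨W1, W2, h1, h2, h3⟩ := h
  exact ⟨W1, W2, h1, h2, h3.trans hr⟩

theorem HR.rch {s x R1 y R2} (h : HR M s (x :: R1) (y :: R2)) : Rch M x y s := by
  obtain ⟨W1, W2, h1, h2, h3⟩ := h
  exact ⟨W1, W2, _, _, h1, h2, h3⟩

theorem InvT.run {s Z R t Z' R'} (h : InvT M s Z R)
    (hr : ∀ T, Run M s (Z ++ T) R t (Z' ++ T) R') : InvT M t Z' R' :=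
  fun T hT => (h T hT).run (hr T)

theorem InvT.pre {s Z Z' R} (h : InvT M s Z R) (hZ : IsL Z') : InvT M s (Z ++ Z') R := by
  intro T hT
  rw [List.append_assoc]
  exact h _ (hZ.app hT)

theorem cellBig {B} (hB : ∀ x y s t k, UPass M x y s t k → k ≤ B) {x N β} (hN : β ≤ N)
    (hβ : B < β) (L : List Sy) : ∀ s y n, β ≤ n →
    Dead M s [x] (rp n y ++ Blk N L) ∨
    (∃ t y' n' L', (y' :: L') <:+ (y :: L) ∧ β ≤ n' + B ∧
      ∀ T V, Run M s (x :: T) (rp n y ++ Blk N L ++ V) t T (rp n' y' ++ Blk N L' ++ V)) ∨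
    ∃ s', UWalk M.sw x s (rp n y ++ Blk N L) s' 0 := by
  induction L with
  | nil =>
    intro s y n hn
    by_cases hp : ∃ t k, UPass M x y s t k
    · obtain ⟨t, k, hp⟩ := hp
      have := hB _ _ _ _ _ hp
      right; left
      refine ⟨t, y, n - k, [], List.suffix_rfl, by omega, fun T V => ?_⟩
      simpa [Blk_nil] using hp.run (n := n) (by omega) T V
    · rcases phase hp n with ⟨s', h1, h2⟩ | h1
      · right; right; exact ⟨s', by simpa [Blk_nil] using h1⟩
      · left; exact h1.monoR _
  | cons y2 L ih =>
    intro s y n hn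
    by_cases hp : ∃ t k, UPass M x y s t k
    · obtain ⟨t, k, hp⟩ := hp
      have := hB _ _ _ _ _ hp
      right; left
      refine ⟨t, y, n - k, y2 :: L, List.suffix_rfl, by omega, fun T V => ?_⟩
      simpa only [List.append_assoc] using hp.run (n := n) (by omega) T (Blk N (y2 :: L) ++ V)
    · rcases phase hp n with ⟨s', h1, h2⟩ | h1
      · rcases ih s' y2 N hN with h3 | ⟨t, y', n', L', h3, h4, h5⟩ | ⟨s2, h3⟩
        · left
          refine Dead.of_run (fun T V => ?_) h3
          have := h1.run_sw T (rp N y2 ++ Blk N L ++ V)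
          simpa [Blk_cons] using this
        · right; left
          refine ⟨t, y', n', L', h3.trans (List.suffix_cons _ _), h4, fun T V => ?_⟩
          have := (h1.run_sw T (rp N y2 ++ Blk N L ++ V)).trans (h5 T V)
          simpa [Blk_cons] using this
        · right; right
          refine ⟨s2, ?_⟩
          have := h1.append h3
          simpa [Blk_cons] using this
      · left; exact h1.monoR _

section fin
variable [Fintype S]

theorem conv (hI : M.Inj) {y h} (hh : cm S ≤ h * La S) (c : ℕ) : ∀ {s t k},
    UWalk M y s (pw (rp (1 + h * La S) sb ++ rp (1 + h * La S) sa) c) t k →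
    ∃ k', UWalk M y s (pw (rho S) c) t k' ∧ (k = 0 → k' = 0) := by
  induction c with
  | zero => intro s t k h; exact ⟨k, h, id⟩
  | succ c ih =>
    intro s t k hw
    rw [pw_succ] at hw
    obtain ⟨t1, k1, k2, h1, h2, rfl⟩ := hw.split
    obtain ⟨t2, k3, k4, h3, h4, rfl⟩ := h1.split
    obtain ⟨k5, h5, h5'⟩ := resize hI hh h3 (La S)
    obtain ⟨k6, h6, h6'⟩ := resize hI hh h4 (La S)
    obtain ⟨k7, h7, h7'⟩ := ih h2
    refine ⟨k5 + k6 + k7, ?_, fun hk => ?_⟩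
    · rw [pw_succ, rho]
      exact (h5.append h6).append h7
    · rw [h5' (by omega), h6' (by omega), h7' (by omega)]

variable (S) in
def Rich (g : ℕ) (L : List Sy) : Prop := ∃ p, IsL p ∧ L = p ++ pw [sb, sa] (cm S * g)

theorem Rich.isL {g L} (h : Rich S g L) : IsL L := by
  obtain ⟨p, hp, rfl⟩ := h
  exact hp.app (IsL.pw (IsL.cons ⟨_, rfl⟩ IsL.one))

/-- exhaustion is impossible on rich tapes -/
theorem no_exh (hI : M.Inj) {h} (hh : cm S ≤ h * La S) (hS : ¬ ScenI M.sw) {x y s n p s' L}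
    (hR : Rch M x y s) (hy : ∃ c, y = Sum.inl c) (hn : 1 ≤ n) (hp : IsL p)
    (hw : UWalk M.sw x s (rp n y ++ Blk (1 + h * La S) (p ++ pw [sb, sa] (cm S) ++ L)) s' 0) : False := by
  apply hS
  obtain ⟨n, rfl⟩ : ∃ n', n = n' + 1 := ⟨n - 1, by omega⟩
  rw [Blk_append, Blk_append, Blk_pw, ← List.append_assoc, ← List.append_assoc] at hw
  obtain ⟨t1, k1, k2, h1, -, hk⟩ := hw.split
  obtain ⟨t2, k3, k4, h3, h4, hk'⟩ := h1.split
  have e : Blk (1 + h * La S) [sb, sa] = rp (1 + h * La S) sb ++ rp (1 + h * La S) sa := by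
    simp [Blk]
  rw [e] at h4
  obtain ⟨k5, h5, h5'⟩ := conv (Inj.sw hI) hh _ h4
  obtain ⟨c, rfl⟩ := hy
  refine ⟨_, x, s, rp n (Sum.inl c) ++ Blk (1 + h * La S) p, t1, k3 + k5, hR.sw, IsL.rp.app (Blk_L hp), ?_, .inr ?_⟩
  · have := h3.append h5
    simpa [rp_succ] using this
  · rw [h5' (by omega)]; omega

theorem walkT1 (hI : M.Inj) {h B} (hh : cm S ≤ h * La S) (hS : ¬ ScenI M.sw)
    (hB : ∀ x y s t k, UPass M x y s t k → k ≤ B) (g : ℕ) (Z : List Sy) : ∀ s y n L β,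
    InvT M s Z (rp n y ++ Blk (1 + h * La S) L) → (∃ c, y = Sum.inl c) → β ≤ n → β ≤ 1 + h * La S →
    B * Z.length < β → Rich S (Z.length + g) L →
    Dead M s Z (rp n y ++ Blk (1 + h * La S) L) ∨
    ∃ t y' n' L', (∃ c, y' = Sum.inl c) ∧ Rich S g L' ∧ β ≤ n' + B * Z.length ∧
      ∀ T V, Run M s (Z ++ T) (rp n y ++ Blk (1 + h * La S) L ++ V) t T
        (rp n' y' ++ Blk (1 + h * La S) L' ++ V) := by
  generalize hN : 1 + h * La S = N
  induction Z with
  | nil =>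
    intro s y n L β _ hy hn _ _ hL
    right
    exact ⟨s, y, n, L, hy, by simpa using hL, by omega, fun T V => .refl _ _ _⟩
  | cons x Z ih =>
    intro s y n L β hinv hy hn hnN hBβ hL
    obtain ⟨p, hp, rfl⟩ := hL
    simp only [List.length_cons, mul_add, mul_one] at hBβ
    have e : cm S * ((x :: Z).length + g) = cm S + cm S * (Z.length + g) := by
      simp; ring
    rw [e, pw_add, ← List.append_assoc] at hinv ⊢
    rw [Blk_append] at hinv ⊢
    generalize hD : pw [sb, sa] (cm S * (Z.length + g)) = D at hinv ⊢
    have hrch : Rch M x y s := by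
      have := hinv [] IsL.nil
      obtain ⟨n', rfl⟩ : ∃ n', n = n' + 1 := ⟨n - 1, by omega⟩
      rw [rp_succ] at this
      exact HR.rch (by simpa using this)
    rcases cellBig hB hnN (x := x) (by omega) (p ++ pw [sb, sa] (cm S)) s y n hn with h1 | ⟨t, y', n', L', h1, h2, h3⟩ | ⟨s', h1⟩
    · left
      have := h1.mono Z (Blk N D)
      simpa using this
    · have hpL : IsL (y :: (p ++ pw [sb, sa] (cm S))) :=
        IsL.cons hy (hp.app (IsL.pw (IsL.cons ⟨_, rfl⟩ IsL.one)))
      have hL' := hpL.suf h1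
      have hr : ∀ T V, Run M s (x :: Z ++ T) (rp n y ++ (Blk N (p ++ pw [sb, sa] (cm S)) ++ Blk N D) ++ V)
          t (Z ++ T) (rp n' y' ++ Blk N (L' ++ D) ++ V) := by
        intro T V
        have := h3 (Z ++ T) (Blk N D ++ V)
        simpa [Blk_append] using this
      rcases ih t y' n' (L' ++ D) (β - B)
        (hinv.run (fun T => by simpa using hr T [])) (hL' y' (by simp)) (by omega) (by omega) (by omega)
        ⟨L', fun z hz => hL' z (by simp [hz]), by rw [hD]⟩ with h4 | ⟨t2, y2, n2, L2, h4, h5, h6, h7⟩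
      · left; exact Dead.of_run hr h4
      · right
        refine ⟨t2, y2, n2, L2, h4, h5, ?_, fun T V => (hr T V).trans (h7 T V)⟩
        simp only [List.length_cons, mul_add, mul_one]; omega
    · exfalso
      subst hN
      refine no_exh (S := S) (n := n) hI hh hS hrch hy (by omega) hp (L := []) ?_ (s' := s')
      simpa using h1

theorem emptySite (hI : M.Inj) (s : S) : IndT M s (rp (nn S) sb) [] ∨
    ∀ T, Acc M s (rp (nn S) sb ++ T) [] ↔ Acc M s (sb :: T) [] := by
  have hc := cm_lt_nn (S := S)
  rcases empty_const (M := M) s (rp (cm S + 1) sb) with ⟨t, k, h⟩ | h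
  · right
    intro T
    obtain ⟨t1, k1, e, h1, h2, -⟩ := block hI h
    have h3 := block_q h1 h2 (La S)
    rw [show 1 + La S * La S = nn S from rfl] at h3
    rw [(h3.run_nil T).acc, (h1.run_nil T).acc]
  · left
    have := h.mono (rp (nn S - (cm S + 1)) sb)
    rwa [← rp_add, show cm S + 1 + (nn S - (cm S + 1)) = nn S by omega] at this

/-- maximal walk on a block -/
theorem max_walk {x y : Sy} (c : ℕ) : ∀ s : S, (∃ t k, UWalk M y s (rp c x) t k) ∨
    ∃ j t k, j < c ∧ UWalk M y s (rp j x) t k ∧ ¬ ∃ t' k', UPass M x y t t' k' := by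
  induction c with
  | zero => intro s; left; exact ⟨s, 0, .nil _⟩
  | succ c ih =>
    intro s
    by_cases hp : ∃ t k, UPass M x y s t k
    · obtain ⟨t, k, hp⟩ := hp
      rcases ih t with ⟨t', k', h⟩ | ⟨j, t', k', h1, h2, h3⟩
      · left; exact ⟨t', k + k', by rw [rp_succ]; exact .cons hp h⟩
      · right; exact ⟨j + 1, t', k + k', by omega, by rw [rp_succ]; exact .cons hp h2, h3⟩
    · right; exact ⟨0, s, 0, by omega, .nil _, hp⟩

theorem UWalk.arr {x y : Sy} {s t : S} {j k} (h : UWalk M y s (rp (j+1) x) t k) : Arr M x y t := by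
  rw [rp_add] at h
  obtain ⟨t1, k1, k2, -, h2, -⟩ := h.split
  exact (UWalk.pass h2).arr

variable (S) in
def Qs : List Sy := rp (nn S) sa ++ pw (rho S) (cm S)

theorem site (hI : M.Inj) {N B β} (hS : ¬ ScenI M)
    (hB : ∀ x y s t k, UPass M x y s t k → k ≤ B) (hN : β ≤ N)
    (hβ : B * (nn S) + B * (Qs S).length + cm S < β) (L : List Sy) : ∀ s y n,
    IsL L → InvT M s [sb] (rp n y ++ Blk N L) → (∃ c, y = Sum.inl c) → β ≤ n →
    Dead M s (rp (nn S) sb) (rp n y ++ Blk N L) ∨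
    (∀ T V, Acc M s (rp (nn S) sb ++ Qs S ++ T) (rp n y ++ Blk N L ++ V) ↔
      Acc M s (sb :: Qs S ++ T) (rp n y ++ Blk N L ++ V)) ∨
    ∃ s', UWalk M.sw sb s (rp n y ++ Blk N L) s' 0 := by
  have hc := cm_lt_nn (S := S)
  have main : ∀ (L : List Sy) s y n, InvT M s [sb] (rp n y ++ Blk N L) → (∃ c, y = Sum.inl c) → β ≤ n →
      (∃ t k, UPass M sb y s t k) → Dead M s (rp (nn S) sb) (rp n y ++ Blk N L) ∨
    (∀ T V, Acc M s (rp (nn S) sb ++ Qs S ++ T) (rp n y ++ Blk N L ++ V) ↔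
      Acc M s (sb :: Qs S ++ T) (rp n y ++ Blk N L ++ V)) := by
    intro L s y n hinv hy hn hp
    rcases max_walk (M := M) (x := sb) (y := y) (cm S + 1) s with ⟨t, k, h1⟩ | ⟨j, t, k, hj, h1, h2⟩
    · right
      intro T V
      obtain ⟨t1, k1, e, h2, h3, -⟩ := block hI h1
      have h4 := block_q h2 h3 (La S)
      rw [show 1 + La S * La S = nn S from rfl] at h4
      have b1 := h4.bound hB
      simp only [List.length_replicate] at b1
      have hno : ¬ ∃ t k, UWalk M y t1 (Qs S) t k := by
        rintro ⟨t, k, hw⟩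
        apply hS
        have hn1 := nn_pos (S := S)
        obtain ⟨c, rfl⟩ := hy
        refine ⟨sa, Sum.inl c, t1, rp (nn S - 1) sa, t, k, ?_, IsL.rp, ?_, .inl ⟨c, rfl⟩⟩
        · have h5 := (hinv [sa] IsL.one).run
            (h2.run (n := n) (by omega) [sa] (Blk N L))
          obtain ⟨n', hn'⟩ : ∃ n', n - k1 = n' + 1 := ⟨n - k1 - 1, by omega⟩
          rw [hn', rp_succ] at h5
          exact HR.rch h5
        · have e : rp (nn S) sa = sa :: rp (nn S - 1) sa := by
            rw [← rp_succ]; congr 1; omega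
          simpa [Qs, e] using hw
      have r1 := h4.run (n := n) (by omega) (Qs S ++ T) (Blk N L ++ V)
      have r2 := h2.run (n := n) (by omega) (Qs S ++ T) (Blk N L ++ V)
      have sy := sync hI hB hno (n := n - (k1 + La S * e)) (j := e) (by omega) T (Blk N L ++ V)
      rw [show n - (k1 + La S * e) + e * La S = n - k1 by rw [mul_comm e]; omega] at sy
      simp only [List.append_assoc, List.cons_append] at r1 r2 sy ⊢
      rw [r1.acc, r2.acc]
      exact sy.symm
    · left
      obtain ⟨j, rfl⟩ : ∃ j', j = j' + 1 := by
        cases j with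
        | zero => cases h1; exact (h2 hp).elim
        | succ j => exact ⟨j, rfl⟩
      have ha := h1.arr
      have b1 := h1.bound hB
      simp only [List.length_replicate] at b1
      have b2 : B * (j + 1) ≤ B * nn S := Nat.mul_le_mul_left _ (by omega)
      rcases phase h2 (n - k) with ⟨s', h3, -⟩ | h3
      · exfalso
        rw [show n - k = (cm S + 1) + (n - k - (cm S + 1)) by omega, rp_add] at h3
        obtain ⟨t1, k1, k2, h4, -, hk⟩ := h3.split
        obtain rfl : k1 = 0 := by omega
        exact no_stuck hI ha h4
      · have h4 : Dead M s (rp (j + 1) sb ++ [sb]) (rp n y) := by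
          refine Dead.of_run (fun T V => ?_) h3
          simpa using h1.run (n := n) (by omega) ([sb] ++ T) V
        have := h4.mono (rp (nn S - (j + 2)) sb) (Blk N L)
        have e : rp (j + 1) sb ++ [sb] ++ rp (nn S - (j + 2)) sb = rp (nn S) sb := by
          rw [show [sb] = rp 1 sb from rfl, ← rp_add, ← rp_add]; congr 1; omega
        rwa [e] at this
  induction L with
  | nil =>
    intro s y n hL hinv hy hn
    by_cases hp : ∃ t k, UPass M sb y s t k
    · rcases main [] s y n hinv hy hn hp with h | h
      · exact .inl h
      · exact .inr (.inl h)
    · rcases phase hp n with ⟨s', h1, h2⟩ | h1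
      · right; right; exact ⟨s', by simpa [Blk_nil] using h1⟩
      · left
        have := h1.mono (rp (nn S - 1) sb) (Blk N [])
        rwa [List.singleton_append, ← rp_succ, show nn S - 1 + 1 = nn S by omega] at this
  | cons y2 L ih =>
    intro s y n hL hinv hy hn
    by_cases hp : ∃ t k, UPass M sb y s t k
    · rcases main (y2 :: L) s y n hinv hy hn hp with h | h
      · exact .inl h
      · exact .inr (.inl h)
    · rcases phase hp n with ⟨s', h1, h2⟩ | h1
      · have hr : ∀ T V, Run M s (sb :: T) (rp n y ++ Blk N (y2 :: L) ++ V) s' (sb :: T) (rp N y2 ++ Blk N L ++ V) := by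
          intro T V
          have := h1.run_sw T (rp N y2 ++ Blk N L ++ V)
          simpa [Blk_cons] using this
        have hinv' : InvT M s' [sb] (rp N y2 ++ Blk N L) := by
          refine hinv.run (fun T => ?_)
          simpa using hr T []
        have eb : ∀ T, rp (nn S) sb ++ T = sb :: (rp (nn S - 1) sb ++ T) := by
          intro T
          rw [← List.cons_append, ← rp_succ, show nn S - 1 + 1 = nn S by omega]
        rcases ih s' y2 N (fun z hz => hL z (by simp [hz])) hinv' (hL y2 (by simp)) hN with h3 | h3 | ⟨s2, h3⟩
        · left
          refine Dead.of_run (fun T V => ?_) h3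
          rw [eb]
          exact hr _ V
        · right; left
          intro T V
          have h4 := h3 T V
          simp only [eb, List.cons_append] at h4 ⊢
          rw [(hr _ V).acc, (hr _ V).acc]
          exact h4
        · right; right
          refine ⟨s2, ?_⟩
          have := h1.append h3
          simpa [Blk_cons] using this
      · left
        have := h1.mono (rp (nn S - 1) sb) (Blk N (y2 :: L))
        rwa [List.singleton_append, ← rp_succ, show nn S - 1 + 1 = nn S by omega] at this

end fin
end WKP

set_option linter.unusedSectionVars false
namespace WKP
variable {S : Type} {M : Mc S}

def Good (N β : ℕ) (R : List Sy) : Prop := R = [] ∨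
  ∃ y n L, (∃ c, y = Sum.inl c) ∧ β ≤ n ∧ IsL L ∧ R = rp n y ++ Blk N L

theorem Good.mono {N β β' R} (h : Good N β R) (hb : β' ≤ β) : Good N β' R := by
  rcases h with h | ⟨y, n, L, h1, h2, h3⟩
  · exact .inl h
  · exact .inr ⟨y, n, L, h1, by omega, h3⟩

theorem good_blk {N L} (h : IsL L) : Good N N (Blk N L) := by
  cases L with
  | nil => exact .inl rfl
  | cons y L => exact .inr ⟨y, N, L, h y (by simp), le_rfl, fun z hz => h z (by simp [hz]), Blk_cons _ _ _⟩

theorem suffix_blk {N} (L : List Sy) (hL : IsL L) {R : List Sy} (h : R <:+ Blk N L) : Good N 1 R := by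
  induction L with
  | nil => left; simpa [Blk_nil] using h
  | cons y L ih =>
    rw [Blk_cons] at h
    obtain ⟨P, hP⟩ := h
    rcases List.append_eq_append_iff.1 hP with ⟨a, ha, hb⟩ | ⟨a, ha, hb⟩
    · have := (List.append_eq_replicate_iff.1 ha.symm).2.2
      by_cases h0 : a = []
      · subst h0
        exact ih (fun z hz => hL z (by simp [hz])) (by rw [hb]; exact List.suffix_rfl)
      · right
        refine ⟨y, a.length, L, hL y (by simp), List.length_pos_iff.2 h0, fun z hz => hL z (by simp [hz]), ?_⟩
        rw [hb]; congr 1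
    · exact ih (fun z hz => hL z (by simp [hz])) ⟨a, hb.symm⟩

theorem cell_nil (s : S) (x : Sy) : IndT M s [x] [] ∨ ∃ t, ∀ T, Run M s (x :: T) [] t T [] := by
  rcases empty_const (M := M) s [x] with ⟨t, k, h⟩ | h
  · right; exact ⟨t, fun T => h.run_nil T⟩
  · left; exact h

theorem walkT2 {N B} (hB : ∀ x y s t k, UPass M x y s t k → k ≤ B) (Z : List Sy) : ∀ s R β,
    Good N β R → β ≤ N → B * Z.length < β →
    IndT M s Z R ∨ ∃ t R', Good N (β - B * Z.length) R' ∧ ∀ T, Run M s (Z ++ T) R t T R' := by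
  induction Z with
  | nil =>
    intro s R β h _ _
    right; exact ⟨s, R, by simpa using h, fun T => .refl _ _ _⟩
  | cons x Z ih =>
    intro s R β hR hN hβ
    simp only [List.length_cons, mul_add, mul_one] at hβ ⊢
    have go : ∀ t R', Good N (β - B) R' → (∀ T, Run M s (x :: T) R t T R') →
        IndT M s (x :: Z) R ∨ ∃ t R', Good N (β - (B * Z.length + B)) R' ∧ ∀ T, Run M s (x :: Z ++ T) R t T R' := by
      intro t R' h1 h2
      rcases ih t R' (β - B) h1 (by omega) (by omega) with h3 | ⟨t2, R2, h3, h4⟩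
      · left; exact IndT.of_run (fun T => h2 (Z ++ T)) h3
      · right
        exact ⟨t2, R2, by rwa [show β - (B * Z.length + B) = β - B - B * Z.length by omega],
          fun T => (h2 (Z ++ T)).trans (h4 T)⟩
    have goE : ∀ s', (∀ T, Run M s (x :: T) R s' (x :: T) []) →
        IndT M s (x :: Z) R ∨ ∃ t R', Good N (β - (B * Z.length + B)) R' ∧ ∀ T, Run M s (x :: Z ++ T) R t T R' := by
      intro s' h1
      rcases cell_nil (M := M) s' x with h2 | ⟨t, h2⟩
      · left
        exact IndT.of_run (Z' := x :: Z) (fun T => h1 (Z ++ T)) (h2.mono Z)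
      · exact go t [] (.inl rfl) (fun T => (h1 T).trans (h2 T))
    rcases hR with rfl | ⟨y, n, L, hy, hn, hL, rfl⟩
    · exact goE s (fun T => .refl _ _ _)
    · rcases cellBig hB hN (x := x) (by omega) L s y n hn with h1 | ⟨t, y', n', L', h1, h2, h3⟩ | ⟨s', h1⟩
      · left
        have := (h1.indT []).mono Z
        simpa using this
      · have hyL := (IsL.cons hy hL).suf h1
        refine go t (rp n' y' ++ Blk N L') (.inr ⟨y', n', L', hyL y' (by simp), by omega,
          fun z hz => hyL z (by simp [hz]), rfl⟩) (fun T => ?_)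
        simpa using h3 T []
      · refine goE s' (fun T => ?_)
        simpa using h1.run_sw T []

section fin
variable [Fintype S]

theorem siteT2 (hI : M.Inj) {N B β} (hS : ¬ ScenI M)
    (hB : ∀ x y s t k, UPass M x y s t k → k ≤ B) (hN : β ≤ N)
    (hβ : B * (nn S) + B * (Qs S).length + cm S < β) {s R} (hR : Good N β R) (hinv : InvT M s [sb] R) :
    IndT M s (rp (nn S) sb) R ∨
    (∀ T, Acc M s (rp (nn S) sb ++ Qs S ++ T) R ↔ Acc M s (sb :: Qs S ++ T) R) := by
  have hn1 := nn_pos (S := S)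
  have eb : ∀ T, rp (nn S) sb ++ T = sb :: (rp (nn S - 1) sb ++ T) := by
    intro T
    rw [← List.cons_append, ← rp_succ, show nn S - 1 + 1 = nn S by omega]
  have goE : ∀ s', (∀ T, Run M s (sb :: T) R s' (sb :: T) []) → IndT M s (rp (nn S) sb) R ∨
    (∀ T, Acc M s (rp (nn S) sb ++ Qs S ++ T) R ↔ Acc M s (sb :: Qs S ++ T) R) := by
    intro s' hr
    rcases emptySite hI s' with h | h
    · left
      refine IndT.of_run (fun T => ?_) h
      rw [eb]; exact hr _
    · right
      intro T
      have h1 := h (Qs S ++ T)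
      rw [List.append_assoc, List.cons_append]
      rw [eb] at h1 ⊢
      rw [(hr _).acc, (hr _).acc]; exact h1
  rcases hR with rfl | ⟨y, n, L, hy, hn, hL, rfl⟩
  · exact goE s (fun T => .refl _ _ _)
  · rcases site hI hS hB hN hβ L s y n hL hinv hy hn with h | h | ⟨s', h⟩
    · left; simpa using h.indT []
    · right; intro T; simpa using h T []
    · refine goE s' (fun T => ?_)
      simpa using h.run_sw T []

variable (S) in
def Xs (i d : ℕ) : List Sy := bl S (List.replicate i (nn S) ++ 1 :: List.replicate d (nn S)) ++ rp (nn S) sb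
variable (S) in
def Xb (c : ℕ) : List Sy := pw (rho S) c ++ rp (nn S) sb

theorem Xs_L {i d} : IsL (Xs S i d) := (bl_L _).app IsL.rp
theorem Xb_L {c} : IsL (Xb S c) := rho_L.pw.app IsL.rp
theorem Xs_rev (i d) : (Xs S (i+1) d).reverse = Xs S (d+1) i := by
  unfold Xs
  rw [List.replicate_succ, List.cons_append, bl_rev]
  congr 2
  simp [List.replicate_succ]
theorem Xb_rev (c) : (Xb S (c+1)).reverse = Xb S (c+1) := by
  unfold Xb
  rw [← bl_rep, List.replicate_succ, bl_rev]
  simp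

theorem Xs_eq {i d} (hd : cm S ≤ d) : Xs S i d =
    pw (rho S) i ++ (sb :: Qs S ++ (pw (rho S) (d - cm S) ++ rp (nn S) sb)) := by
  obtain ⟨e, rfl⟩ : ∃ e, d = cm S + e := ⟨d - cm S, by omega⟩
  rw [Xs, bl_append, bl_cons, bl_rep, bl_rep, pw_add, Qs]
  simp
theorem Xb_eq {i d} (hd : cm S ≤ d) : Xb S (i + 1 + d) =
    pw (rho S) i ++ (rp (nn S) sb ++ Qs S ++ (pw (rho S) (d - cm S) ++ rp (nn S) sb)) := by
  obtain ⟨e, rfl⟩ : ∃ e, d = cm S + e := ⟨d - cm S, by omega⟩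
  rw [Xb, pw_add, pw_add, pw_add, pw_one, Qs]
  nth_rewrite 2 [rho]
  simp

theorem tog_X {Q} (hT : Tog Q) {i d Y} (hi : 1 ≤ i) : Q (Xs S i d ++ Y) ↔ ¬ Q (Xb S (i + 1 + d) ++ Y) := by
  have := tog_bl (S := S) hT (ks := List.replicate i (nn S)) (ks' := List.replicate d (nn S)) (by simp; omega)
    (nn_two (S := S)) [] (rp (nn S) sb ++ Y)
  have e : List.replicate i (nn S) ++ nn S :: List.replicate d (nn S) = List.replicate (i + 1 + d) (nn S) := by
    rw [← List.replicate_succ, List.replicate_append_replicate]; congr 1; omega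
  rw [e, bl_rep] at this
  simpa [Xs, Xb] using this

theorem T2core (hI : M.Inj) {N B} (hS : ¬ ScenI M)
    (hB : ∀ x y s t k, UPass M x y s t k → k ≤ B) {j d} (hj : cm S + 1 ≤ j) (hd : cm S ≤ d)
    (hN : B * (pw (rho S) j).length + (B * (nn S) + B * (Qs S).length + cm S) < N)
    {s R} (hR : Good N 1 R) (hinv : InvT M s [] R) :
    IndT M s (pw (rho S) j ++ rp (nn S) sb) R ∨
    (∀ T, Acc M s (Xb S (j + 1 + d) ++ T) R ↔ Acc M s (Xs S j d ++ T) R) := by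
  have hn1 := nn_pos (S := S)
  have fin : ∀ s' Z R', (∀ T, Run M s (pw (rho S) j ++ T) R s' (Z ++ T) R') → Good N N R' →
      Z.length ≤ (pw (rho S) j).length → 
      IndT M s (pw (rho S) j ++ rp (nn S) sb) R ∨
      (∀ T, Acc M s (Xb S (j + 1 + d) ++ T) R ↔ Acc M s (Xs S j d ++ T) R) := by
    intro s' Z R' hr hG hZ
    have hZ' := Nat.mul_le_mul_left B hZ
    rcases walkT2 hB Z s' R' N hG le_rfl (by omega) with h1 | ⟨t, R2, h1, h2⟩
    · left
      refine IndT.of_run (Z' := Z ++ rp (nn S) sb) (fun T => ?_) (h1.mono _)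
      simpa using hr (rp (nn S) sb ++ T)
    · have hr2 : ∀ T, Run M s (pw (rho S) j ++ T) R t T R2 := fun T => (hr T).trans (h2 T)
      have hinv2 : InvT M t [sb] R2 := by
        refine (hinv.pre (Z' := pw (rho S) j ++ [sb]) (rho_L.pw.app IsL.one)).run (fun T => ?_)
        simpa using hr2 (sb :: T)
      rcases siteT2 hI hS hB (β := N - B * Z.length) (by omega) (by omega) h1 hinv2 with h3 | h3
      · left
        refine IndT.of_run (fun T => ?_) h3
        simpa using hr2 (rp (nn S) sb ++ T)
      · right
        intro T
        have h4 := h3 (pw (rho S) (d - cm S) ++ rp (nn S) sb ++ T)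
        rw [Xs_eq hd, Xb_eq hd, List.append_assoc (pw (rho S) j), List.append_assoc (pw (rho S) j),
          (hr2 _).acc, (hr2 _).acc]
        simpa using h4
  rcases hR with rfl | ⟨y, n, L, hy, hn, hL, rfl⟩
  · exact fin s (pw (rho S) j) [] (fun T => .refl _ _ _) (.inl rfl) le_rfl
  · have e : rho S = sb :: (rp (nn S - 1) sb ++ rp (nn S) sa) := by
      rw [← List.cons_append, ← rp_succ, show nn S - 1 + 1 = nn S by omega]; rfl
    have hno : ¬ ∃ t k, UWalk M y s (pw (rho S) (cm S + 1)) t k ∧ k < n := by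
      rintro ⟨t, k, hw, -⟩
      apply hS
      refine ⟨sb, y, s, rp (nn S - 1) sb ++ rp (nn S) sa, t, k, ?_, IsL.rp.app IsL.rp, ?_, .inl hy⟩
      · have := hinv [sb] IsL.one
        obtain ⟨n', rfl⟩ : ∃ n', n = n' + 1 := ⟨n - 1, by omega⟩
        rw [rp_succ] at this
        exact HR.rch this
      · rw [pw_succ] at hw
        nth_rewrite 1 [e] at hw
        exact hw
    have ej : pw (rho S) j = pw (rho S) (cm S + 1) ++ pw (rho S) (j - (cm S + 1)) := by
      rw [← pw_add]; congr 1; omega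
    rcases start hn hno with h1 | ⟨s', Z', h1, h2⟩
    · left
      have := (h1.indT (Blk N L)).mono (pw (rho S) (j - (cm S + 1)) ++ rp (nn S) sb)
      rw [ej]
      simpa using this
    · refine fin s' (Z' ++ pw (rho S) (j - (cm S + 1))) (Blk N L) (fun T => ?_) (good_blk hL) ?_
      · have := h2 (pw (rho S) (j - (cm S + 1)) ++ T) (Blk N L)
        rw [ej]
        simpa using this
      · rw [ej]; simp [h1.length_le]

end fin
end WKP

set_option linter.unusedSectionVars false
namespace WKP
variable {S : Type} {M : Mc S}
section fin
variable [Fintype S]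

variable (S) in
def DD (g : ℕ) : List Sy := pw [sb, sa] (cm S * (g + 1))

theorem DD_L {g} : IsL (DD S g) := IsL.pw (IsL.cons ⟨_, rfl⟩ IsL.one)

theorem cross (hI : M.Inj) {h B β} (hm : 1 ≤ cm S) (hh : cm S ≤ h * La S) (hS : ¬ ScenI M) (hS' : ¬ ScenI M.sw)
    (hB : ∀ x y s t k, UPass M x y s t k → k ≤ B) {Z1 : List Sy} (hZ1 : IsL Z1) {g} 
    (hg : g = (M.l :: pw (rho S) (cm S) ++ Z1).length + 1)
    (hN : B * g + β < 1 + h * La S) :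
    Dead M M.s0 (M.l :: pw (rho S) (cm S) ++ Z1) (M.r :: Blk (1 + h * La S) (DD S g)) ∨
    ∃ t y n L, (∃ c, y = Sum.inl c) ∧ Rich S 1 L ∧ β ≤ n ∧
      ∀ T V, Run M M.s0 (M.l :: pw (rho S) (cm S) ++ Z1 ++ T) (M.r :: Blk (1 + h * La S) (DD S g) ++ V) t T
        (rp n y ++ Blk (1 + h * La S) L ++ V) := by
  have hno : ¬ ∃ t k, UWalk M M.r M.s0 (M.l :: pw (rho S) (cm S)) t k ∧ k < 1 := by
    rintro ⟨t, k, hw, hk⟩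
    exact hS ⟨M.l, M.r, M.s0, [], t, k, Rch.start, IsL.nil, by simpa using hw, .inr (by omega)⟩
  rcases start le_rfl hno with h1 | ⟨s', Z', h1, h2⟩
  · left
    have := h1.mono Z1 (Blk (1 + h * La S) (DD S g))
    simpa using this
  · have eD : DD S g = sb :: (sa :: pw [sb, sa] (cm S - 1) ++ pw [sb, sa] (cm S * g)) := by
      rw [DD, mul_add, mul_one, add_comm, pw_add]
      obtain ⟨m, hm'⟩ : ∃ m, cm S = m + 1 := ⟨cm S - 1, by omega⟩
      rw [hm', pw_succ]; simp
    generalize hL0 : sa :: pw [sb, sa] (cm S - 1) ++ pw [sb, sa] (cm S * g) = L0 at eD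
    generalize hNN : 1 + h * La S = N at *
    have hr : ∀ T V, Run M M.s0 (M.l :: pw (rho S) (cm S) ++ Z1 ++ T) (M.r :: Blk N (DD S g) ++ V) s'
        ((Z' ++ Z1) ++ T) (rp N sb ++ Blk N L0 ++ V) := by
      intro T V
      have := h2 (Z1 ++ T) (Blk N (DD S g) ++ V)
      rw [eD, Blk_cons] at this ⊢
      simpa using this
    have hlen := h1.length_le
    simp only [List.length_cons, List.length_append] at hg hlen
    have hinv : InvT M s' (Z' ++ Z1) (rp N sb ++ Blk N L0) := by
      intro T hT
      refine ⟨pw (rho S) (cm S) ++ Z1 ++ T, Blk N (DD S g), (rho_L.pw.app hZ1).app hT, Blk_L DD_L, ?_⟩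
      simpa using hr T []
    have hlen2 : (Z' ++ Z1).length + 1 ≤ g := by simp; omega
    have hmul := Nat.mul_le_mul_left B hlen2
    rw [mul_add] at hmul
    subst hNN
    rcases walkT1 hI hh hS' hB (g - (Z' ++ Z1).length) (Z' ++ Z1) s' sb (1 + h * La S) L0 (1 + h * La S) hinv ⟨_, rfl⟩ le_rfl le_rfl
      (by omega) ⟨sa :: pw [sb, sa] (cm S - 1), IsL.cons ⟨_, rfl⟩ (IsL.pw (IsL.cons ⟨_, rfl⟩ IsL.one)), by
        rw [← hL0, show (Z' ++ Z1).length + (g - (Z' ++ Z1).length) = g by omega]⟩ with h3 | ⟨t, y, n, L, h3, h4, h5, h6⟩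
    · left
      exact Dead.of_run hr h3
    · right
      refine ⟨t, y, n, L, h3, ?_, by omega, fun T V => (hr T V).trans (h6 T V)⟩
      obtain ⟨p, hp, rfl⟩ := h4
      obtain ⟨q, hq⟩ : ∃ q, g - (Z' ++ Z1).length = q + 1 := ⟨g - (Z' ++ Z1).length - 1, by omega⟩
      refine ⟨p ++ pw [sb, sa] (cm S * q), hp.app (IsL.pw (IsL.cons ⟨_, rfl⟩ IsL.one)), ?_⟩
      rw [hq, mul_add, pw_add, List.append_assoc]

theorem T1 (hI : M.Inj) {h B} (hm : 1 ≤ cm S) (hh : cm S ≤ h * La S) (hS : ¬ ScenI M) (hS' : ¬ ScenI M.sw)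
    (hB : ∀ x y s t k, UPass M x y s t k → k ≤ B) {i d} (hi : cm S ≤ i) (hd : cm S ≤ d) {g g'} 
    (hg : g' = (M.l :: pw (rho S) i).length + 1) (hgg : g' ≤ g)
    (hN : B * g + (B * (nn S) + B * (Qs S).length + cm S + 1) < 1 + h * La S) :
    Dead M M.s0 (M.l :: pw (rho S) i ++ rp (nn S) sb) (M.r :: Blk (1 + h * La S) (DD S g)) ∨
    ∀ T V, Acc M M.s0 (M.l :: Xb S (i + 1 + d) ++ T) (M.r :: Blk (1 + h * La S) (DD S g) ++ V) ↔
      Acc M M.s0 (M.l :: Xs S i d ++ T) (M.r :: Blk (1 + h * La S) (DD S g) ++ V) := by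
  have hn1 := nn_pos (S := S)
  have ei : pw (rho S) i = pw (rho S) (cm S) ++ pw (rho S) (i - cm S) := by
    rw [← pw_add]; congr 1; omega
  have eg : DD S g = DD S g' ++ pw [sb, sa] (cm S * (g - g')) := by
    rw [DD, DD, ← pw_add, ← mul_add]; congr 2; omega
  generalize pw [sb, sa] (cm S * (g - g')) = E at eg
  have hmul := Nat.mul_le_mul_left B hgg
  rcases cross hI hm hh hS hS' hB (Z1 := pw (rho S) (i - cm S)) rho_L.pw (g := g')
    (β := B * (nn S) + B * (Qs S).length + cm S + 1) (by rw [hg, ei]; simp) (by omega) with h1 | ⟨t, y, n, L, hy, hL, hn, hr⟩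
  · left
    rw [eg, ei, Blk_append]
    have := h1.mono (rp (nn S) sb) (Blk (1 + h * La S) E)
    simpa using this
  · have hr2 : ∀ T V, Run M M.s0 (M.l :: pw (rho S) i ++ T) (M.r :: Blk (1 + h * La S) (DD S g') ++ V) t T
        (rp n y ++ Blk (1 + h * La S) L ++ V) := by
      intro T V
      rw [ei]; simpa using hr T V
    have hinv : InvT M t [sb] (rp n y ++ Blk (1 + h * La S) L) := by
      intro T hT
      refine ⟨pw (rho S) i ++ sb :: T, Blk (1 + h * La S) (DD S g'), rho_L.pw.app (IsL.cons ⟨_, rfl⟩ hT), Blk_L DD_L, ?_⟩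
      simpa using hr2 (sb :: T) []
    rcases site hI hS hB (N := 1 + h * La S) (β := B * (nn S) + B * (Qs S).length + cm S + 1) (by omega) (by omega)
      L t y n hL.isL hinv hy hn with h3 | h3 | ⟨s', h3⟩
    · left
      rw [eg, Blk_append]
      have h4 : Dead M M.s0 (M.l :: pw (rho S) i ++ rp (nn S) sb) (M.r :: Blk (1 + h * La S) (DD S g')) := by
        refine Dead.of_run (fun T V => ?_) h3
        simpa using hr2 (rp (nn S) sb ++ T) V
      simpa using h4.monoR (Blk (1 + h * La S) E)
    · right
      intro T V
      have h4 := h3 (pw (rho S) (d - cm S) ++ rp (nn S) sb ++ T) (Blk (1 + h * La S) E ++ V)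
      have h5 := (hr2 (rp (nn S) sb ++ Qs S ++ (pw (rho S) (d - cm S) ++ rp (nn S) sb ++ T)) (Blk (1 + h * La S) E ++ V)).acc
      have h6 := (hr2 (sb :: Qs S ++ (pw (rho S) (d - cm S) ++ rp (nn S) sb ++ T)) (Blk (1 + h * La S) E ++ V)).acc
      have := h5.trans (h4.trans h6.symm)
      rw [Xs_eq hd, Xb_eq hd, eg, Blk_append]
      simpa using this
    · exfalso
      obtain ⟨p, hp, rfl⟩ := hL
      rw [mul_one] at h3 hinv
      refine no_exh (S := S) hI hh hS' (x := sb) (y := y) (s := t) (n := n) (p := p) (L := []) ?_ hy (by omega) hp (s' := s') (by simpa using h3)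
      have := hinv [] IsL.nil
      obtain ⟨n', rfl⟩ : ∃ n', n = n' + 1 := ⟨n - 1, by omega⟩
      rw [rp_succ] at this
      exact HR.rch this

theorem T1eq (hI : M.Inj) {Q} (hQ : Rec M Q) (hT : Tog Q) {h B} (hm : 1 ≤ cm S) (hh : cm S ≤ h * La S)
    (hS : ¬ ScenI M) (hS' : ¬ ScenI M.sw)
    (hB : ∀ x y s t k, UPass M x y s t k → k ≤ B) {i d} (hi : cm S ≤ i) (hd : cm S + 1 ≤ d) {g} 
    (hgg : (M.l :: pw (rho S) i).length + 1 ≤ g)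
    (hN : B * g + (B * (nn S) + B * (Qs S).length + cm S + 1) < 1 + h * La S) (T V) :
    Acc M M.s0 (M.l :: Xb S (i + 1 + d) ++ T) (M.r :: Blk (1 + h * La S) (DD S g) ++ V) ↔
      Acc M M.s0 (M.l :: Xs S i d ++ T) (M.r :: Blk (1 + h * La S) (DD S g) ++ V) := by
  rcases T1 hI hm hh hS hS' hB hi (by omega : cm S ≤ d) rfl hgg hN with h1 | h1
  · exfalso
    obtain ⟨d, rfl⟩ : ∃ d', d = d' + 1 := ⟨d - 1, by omega⟩
    generalize hYY : Blk (1 + h * La S) (DD S g) = YR at h1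
    have hYL : IsL YR := by rw [← hYY]; exact Blk_L DD_L
    have h2 := hQ (Xb S (i + 1 + 1 + d) ++ YR.reverse) (Xb_L.app hYL.rev)
    have h3 := hQ (Xs S (i + 1) d ++ YR.reverse) (Xs_L.app hYL.rev)
    have h4 := tog_X (S := S) hT (i := i + 1) (d := d) (Y := YR.reverse) (by omega)
    have e1 : ∃ T, Xb S (i + 1 + 1 + d) = pw (rho S) i ++ rp (nn S) sb ++ T := by
      refine ⟨rp (nn S) sa ++ pw (rho S) (1 + d) ++ rp (nn S) sb, ?_⟩
      rw [Xb, show i + 1 + 1 + d = i + 1 + (1 + d) by omega, pw_add, pw_succ', rho]; simp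
    have e2 : ∃ T, Xs S (i + 1) d = pw (rho S) i ++ rp (nn S) sb ++ T := by
      refine ⟨rp (nn S) sa ++ bl S (1 :: List.replicate d (nn S)) ++ rp (nn S) sb, ?_⟩
      rw [Xs, bl_append, bl_rep, pw_succ', rho]; simp
    obtain ⟨U1, e1⟩ := e1
    obtain ⟨U2, e2⟩ := e2
    have := h1 (U1 ++ YR.reverse) (U2 ++ YR.reverse) (Xb S (i + 1 + 1 + d)).reverse (Xs S (i + 1) d).reverse
    rw [List.reverse_append, List.reverse_reverse] at h2 h3
    have h5 : Acc M M.s0 (M.l :: (Xb S (i + 1 + 1 + d) ++ YR.reverse)) (M.r :: (YR ++ (Xb S (i + 1 + 1 + d)).reverse))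
       ↔ Acc M M.s0 (M.l :: (Xs S (i + 1) d ++ YR.reverse)) (M.r :: (YR ++ (Xs S (i + 1) d).reverse)) := by
      generalize (Xb S (i + 1 + 1 + d)).reverse = A1 at *
      generalize (Xs S (i + 1) d).reverse = A2 at *
      rw [e1, e2]
      simpa using this
    tauto
  · exact h1 T V

theorem scenIII (hI : M.Inj) {Q} (hQ : Rec M Q) (hT : Tog Q) 
    (hS : ¬ ScenI M) (hS' : ¬ ScenI M.sw) : False := by
  have hm : 1 ≤ cm S := Fintype.card_pos_iff.2 ⟨M.s0⟩
  obtain ⟨B1, hB1⟩ := UPass.bound M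
  obtain ⟨B2, hB2⟩ := UPass.bound M.sw
  obtain ⟨B, hBa, hBb⟩ : ∃ B, B1 ≤ B ∧ B2 ≤ B := ⟨B1 + B2, by omega, by omega⟩
  have hB : ∀ x y s t k, UPass M x y s t k → k ≤ B := fun x y s t k h => (hB1 x y s t k h).trans hBa
  have hB' : ∀ x y s t k, UPass M.sw x y s t k → k ≤ B := fun x y s t k h => (hB2 x y s t k h).trans hBb
  have hLa := La_pos (S := S)
  have ec : ∃ m, m = cm S := ⟨_, rfl⟩
  obtain ⟨m, hmm⟩ := ec
  -- sizes
  generalize hc : 2 * cm S + 7 = c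
  have plen : ∀ i, i ≤ c → (pw (rho S) i).length ≤ (Xb S c).length := by
    intro i hi
    obtain ⟨e, rfl⟩ : ∃ e, c = i + e := ⟨c - i, by omega⟩
    rw [Xb, pw_add]; simp
  generalize hg : (M.l :: Xb S c).length + 1 = g
  have hg' := hg
  simp only [List.length_cons] at hg'
  obtain ⟨h, hh, hN⟩ : ∃ h, cm S ≤ h * La S ∧ 
      B * g + (B * (nn S) + B * (Qs S).length + cm S + 1) < 1 + h * La S := by
    refine ⟨B * g + (B * (nn S) + B * (Qs S).length + cm S + 1), ?_, ?_⟩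
    · have := Nat.le_mul_of_pos_right (B * g + (B * (nn S) + B * (Qs S).length + cm S + 1)) hLa; omega
    · have := Nat.le_mul_of_pos_right (B * g + (B * (nn S) + B * (Qs S).length + cm S + 1)) hLa; omega
  have t1 := fun i d (hi : cm S ≤ i) (hd : cm S + 1 ≤ d) (hid : i + 1 + d = c) =>
    T1eq hI hQ hT hm hh hS hS' hB hi hd (g := g) (by simp only [List.length_cons]; have := plen i (by omega); omega) hN
  generalize hYY : Blk (1 + h * La S) (DD S g) = YR at t1
  have hYL : IsL YR := by rw [← hYY]; exact Blk_L DD_L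
  have hrevb : (Xb S c).reverse = Xb S c := by
    obtain ⟨c', rfl⟩ : ∃ c', c = c' + 1 := ⟨c - 1, by omega⟩
    exact Xb_rev c'
  -- what remains: lower tape equality at one of two sites
  have fin : ∀ i d, cm S ≤ i → cm S + 1 ≤ d → i + 1 + 1 + d = c →
      (Acc M M.s0 (M.l :: Xb S c ++ YR.reverse) (M.r :: YR ++ Xb S c) ↔
        Acc M M.s0 (M.l :: Xb S c ++ YR.reverse) (M.r :: YR ++ Xs S (d+1) i)) → False := by
    intro i d hi hd hid hacc
    have h1 := t1 (i+1) d (by omega) hd hid YR.reverse (Xs S (d+1) i)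
    rw [hid] at h1
    have h2 := hQ (Xb S c ++ YR.reverse) (Xb_L.app hYL.rev)
    have h3 := hQ (Xs S (i + 1) d ++ YR.reverse) (Xs_L.app hYL.rev)
    have h4 := tog_X (S := S) hT (i := i + 1) (d := d) (Y := YR.reverse) (by omega)
    rw [List.reverse_append, List.reverse_reverse] at h2 h3
    rw [hrevb] at h2
    rw [Xs_rev] at h3
    rw [hid] at h4
    simp only [List.cons_append] at *
    tauto
  have eXb : M.l :: Xb S c = M.l :: pw (rho S) (cm S) ++ (pw (rho S) (c - cm S) ++ rp (nn S) sb) := by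
    rw [Xb]
    conv_lhs => rw [show c = cm S + (c - cm S) by omega, pw_add]
    simp
  rcases cross hI hm hh hS hS' hB (Z1 := pw (rho S) (c - cm S) ++ rp (nn S) sb) (rho_L.pw.app IsL.rp) (g := g)
    (β := 0) (by rw [← eXb]; exact hg.symm) (by omega) with h1 | ⟨t, y, n, L, hy, hL, hn, hr⟩
  · rw [hYY, ← eXb] at h1
    exact fin (cm S + 2) (cm S + 3) (by omega) (by omega) (by omega) (h1 _ _ _ _)
  · rw [hYY, ← eXb] at hr
    have r0 : ∀ V, Acc M M.s0 (M.l :: Xb S c ++ YR.reverse) (M.r :: YR ++ V) ↔ 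
        Acc M.sw t (rp n y ++ Blk (1 + h * La S) L ++ V) YR.reverse := by
      intro V
      rw [Acc_sw]; exact (hr _ _).acc
    rcases consume (M := M.sw) t (rp n y ++ Blk (1 + h * La S) L) YR.reverse with h2 | ⟨t2, R', hR', hr2⟩
    · refine fin (cm S + 2) (cm S + 3) (by omega) (by omega) (by omega) ?_
      rw [r0, r0]; exact h2 _ _
    · have hG : Good (1 + h * La S) 1 R' := by
        rw [← hYY, Blk_rev] at hR'
        exact suffix_blk _ DD_L.rev hR'
      have hinv : InvT M.sw t2 [] R' := by
        intro T hT
        have h3 : HR M t YR.reverse (rp n y ++ Blk (1 + h * La S) L ++ T) :=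
          ⟨Xb S c ++ YR.reverse, YR ++ T, Xb_L.app hYL.rev, hYL.app hT, by simpa using hr YR.reverse T⟩
        exact h3.sw.run (hr2 T)
      have hNj : ∀ j, j ≤ c → B * (pw (rho S) j).length + (B * (nn S) + B * (Qs S).length + cm S) < 1 + h * La S := by
        intro j hj
        have := Nat.mul_le_mul_left B (show (pw (rho S) j).length ≤ g by have := plen j hj; omega)
        omega
      rcases T2core (M := M.sw) (Inj.sw hI) hS' hB' (j := cm S + 4) (d := cm S + 2) (by omega) (by omega)
        (hNj _ (by omega)) hG hinv with h3 | h3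
      · refine fin (cm S + 1) (cm S + 4) (by omega) (by omega) (by omega) ?_
        rw [r0, r0, (hr2 _).acc, (hr2 _).acc]
        have e1 : ∃ T, Xb S c = pw (rho S) (cm S + 4) ++ rp (nn S) sb ++ T := by
          refine ⟨rp (nn S) sa ++ pw (rho S) (cm S + 2) ++ rp (nn S) sb, ?_⟩
          rw [Xb, show c = (cm S + 4) + 1 + (cm S + 2) by omega, pw_add, pw_succ']
          nth_rewrite 2 [rho]; simp
        have e2 : ∃ T, Xs S (cm S + 4 + 1) (cm S + 1) = pw (rho S) (cm S + 4) ++ rp (nn S) sb ++ T := by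
          refine ⟨rp (nn S) sa ++ bl S (1 :: List.replicate (cm S + 1) (nn S)) ++ rp (nn S) sb, ?_⟩
          rw [Xs, bl_append, bl_rep, pw_succ']
          nth_rewrite 2 [rho]; simp
        obtain ⟨U1, e1⟩ := e1
        obtain ⟨U2, e2⟩ := e2
        rw [e1, e2]
        exact h3 U1 U2
      · refine fin (cm S + 2) (cm S + 3) (by omega) (by omega) (by omega) ?_
        rw [r0, r0, (hr2 _).acc, (hr2 _).acc]
        have := h3 []
        rw [show cm S + 4 + 1 + (cm S + 2) = c by omega] at this
        simpa using this

theorem main_false (hI : M.Inj) {Q} (hQ : Rec M Q) (hT : Tog Q) : False := by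
  by_cases h1 : ScenI M
  · exact scenI_false hI hQ hT h1
  by_cases h2 : ScenI M.sw
  · exact scenI_false (Inj.sw hI) hQ.sw hT.rev h2
  exact scenIII hI hQ hT h1 h2

end fin
end WKP

set_option linter.unusedSectionVars false
namespace WKP
open WK

/-- concrete DFA -/
def dst : Fin 3 × Bool → Bool → Fin 3 × Bool := fun q c =>
  if c then (if q.1 = 0 then 1 else 2, q.2) else (0, if q.1 = 1 then !q.2 else q.2)

def dfa : DFA Bool (Fin 3 × Bool) := ⟨dst, (0, false), {q | q.2 = true}⟩

theorem dst_flip (q : Fin 3) (p : Bool) (c : Bool) :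
    dst (q, !p) c = ((dst (q, p) c).1, !(dst (q, p) c).2) := by
  revert q p c; decide

theorem fold_flip (w : List Bool) : ∀ (q : Fin 3) (p : Bool),
    w.foldl dst (q, !p) = ((w.foldl dst (q, p)).1, !(w.foldl dst (q, p)).2) := by
  induction w with
  | nil => intro q p; rfl
  | cons c w ih =>
    intro q p
    rw [List.foldl_cons, List.foldl_cons, dst_flip, ih]

theorem dst_b (k : ℕ) (p : Bool) : (List.replicate (k+2) true).foldl dst (0, p) = (2, p) := by
  induction k with
  | zero => revert p; decide
  | succ k ih => 
    rw [show k + 1 + 2 = (k + 2) + 1 by omega, List.replicate_succ', List.foldl_append, ih]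
    clear ih
    revert p; decide

theorem dst_a (q : Fin 3 × Bool) : ∃ p, dst q false = (0, p) := ⟨_, rfl⟩

def QQ (W : List Sy) : Prop := W.filterMap Sum.getLeft? ∈ dfa.accepts

theorem fm_inl (w : List Bool) : (w.map (Sum.inl : Bool → Sy)).filterMap Sum.getLeft? = w := by
  induction w with
  | nil => rfl
  | cons a w ih => simpa using ih

theorem mem_dfa (w : List Bool) : w ∈ dfa.accepts ↔ (w.foldl dst (0, false)).2 = true := Iff.rfl

theorem tog_QQ : Tog QQ := by
  intro α β k hk
  unfold QQ
  rw [mem_dfa, mem_dfa]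
  obtain ⟨k, rfl⟩ : ∃ k', k = k' + 2 := ⟨k - 2, by omega⟩
  have e : (rp (k+2) sb).filterMap Sum.getLeft? = List.replicate (k+2) true := by
    have := fm_inl (List.replicate (k+2) true)
    rwa [List.map_replicate] at this
  have e2 : ∀ l : List Sy, (sa :: l).filterMap Sum.getLeft? = false :: l.filterMap Sum.getLeft? := fun l => rfl
  have e3 : ∀ l : List Sy, (sb :: l).filterMap Sum.getLeft? = true :: l.filterMap Sum.getLeft? := fun l => rfl
  rw [List.filterMap_append, List.filterMap_append, e2, e2, List.filterMap_append, e, e3, e2]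
  generalize α.filterMap Sum.getLeft? = a
  generalize β.filterMap Sum.getLeft? = b
  simp only [List.foldl_append, List.foldl_cons]
  obtain ⟨p, hp⟩ := dst_a (a.foldl dst (0, false))
  rw [hp, dst_b]
  have h1 : dst (dst (0, p) true) false = (0, !p) := by clear hp; revert p; decide
  have h2 : dst (2, p) false = (0, p) := by clear h1 hp; revert p; decide
  rw [h1, h2, fold_flip]
  simp

/-- combined machine -/
def mc (A : DPWK Bool) : Mc (A.Q1 × A.Q2) where
  G := fun x y s =>
    match A.δ1 s.1 x (A.μ2 s.2 y), A.δ2 s.2 y (A.μ1 s.1 x) with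
    | some (p, d1), some (q, d2) => if y = Sum.inr false ∧ d2 = true then none else some ((p, q), d1, d2)
    | _, _ => none
  e1 := Sum.inr true
  e2 := Sum.inr false
  l := Sum.inr false
  r := Sum.inr true
  s0 := (A.q01, A.q02)
  F := fun s => s.1 ∈ A.F1 ∨ s.2 ∈ A.F2

theorem mc_G (A : DPWK Bool) (x y s p q d1 d2) : (mc A).G x y s = some ((p, q), d1, d2) ↔
    A.δ1 s.1 x (A.μ2 s.2 y) = some (p, d1) ∧ A.δ2 s.2 y (A.μ1 s.1 x) = some (q, d2) ∧
      ¬ (y = Sum.inr false ∧ d2 = true) := by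
  rcases h1 : A.δ1 s.1 x (A.μ2 s.2 y) with _ | ⟨p', d1'⟩ <;>
  rcases h2 : A.δ2 s.2 y (A.μ1 s.1 x) with _ | ⟨q', d2'⟩ <;>
  simp only [mc, h1, h2]
  · simp
  · simp
  · simp
  · split_ifs with hc
    · simp
      rintro - - - rfl
      exact hc
    · simp
      constructor
      · rintro ⟨⟨rfl, rfl⟩, rfl, rfl⟩
        refine ⟨⟨rfl, rfl⟩, ⟨rfl, rfl⟩, by simpa using hc⟩
      · rintro ⟨⟨rfl, rfl⟩, ⟨rfl, rfl⟩, -⟩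
        exact ⟨⟨rfl, rfl⟩, rfl, rfl⟩

theorem tape_zero (w : List Bool) (j : ℕ) (hj : j ≤ w.length + 1) : tape w j = Sum.inr false ↔ j = 0 := by
  cases j with
  | zero => simp [tape]
  | succ j =>
    have : j < (w.map (Sum.inl : Bool → Sy) ++ [Sum.inr true]).length := by simp; omega
    simp only [tape, List.cons_append, List.getD_cons_succ]
    rw [List.getD_eq_getElem _ _ this]
    have hmem := List.getElem_mem this
    generalize (w.map (Sum.inl : Bool → Sy) ++ [Sum.inr true])[j] = z at hmem
    simp at hmem
    rcases hmem with (⟨h, rfl⟩ | ⟨h, rfl⟩) | rfl <;> simp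

theorem mc_step (A : DPWK Bool) (w : List Bool) (c c' : Config A) (hj : c.j ≤ w.length + 1) :
    Step A w c c' ↔ ∃ d1 d2, (mc A).G (tape w c.i) (tape w c.j) (c.p, c.q) = some ((c'.p, c'.q), d1, d2) ∧
      c'.i = c.i + cond d1 1 0 ∧ c'.j = c.j - cond d2 1 0 := by
  unfold Step
  simp only [mc_G, tape_zero w c.j hj]
  constructor
  · rintro ⟨d1, d2, h1, h2, h3, h4⟩
    refine ⟨d1, d2, ⟨h1, h2, ?_⟩, h3, by omega⟩
    rintro ⟨h5, rfl⟩
    simp at h4; omega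
  · rintro ⟨d1, d2, ⟨h1, h2, h5⟩, h3, h4⟩
    refine ⟨d1, d2, h1, h2, h3, ?_⟩
    cases d2
    · simpa using h4.symm
    · simp at h4 h5 ⊢; omega

theorem mc_inj (A : DPWK Bool) (hA : Reversible A) : (mc A).Inj := by
  obtain ⟨R⟩ := hA
  rintro x y ⟨s1, s2⟩ ⟨s1', s2'⟩ ⟨t1, t2⟩ d1 d2 d1' d2' h h'
  have hpos : ∀ z : Sy, ∃ i ≤ 3, tape [false, true] i = z := by
    rintro ((_ | _) | (_ | _))
    · exact ⟨1, by omega, rfl⟩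
    · exact ⟨2, by omega, rfl⟩
    · exact ⟨0, by omega, rfl⟩
    · exact ⟨3, by omega, rfl⟩
  obtain ⟨i, hi, rfl⟩ := hpos x
  obtain ⟨j, hj, rfl⟩ := hpos y
  have a1 := (mc_step A [false, true] ⟨s1, i, s2, j⟩ ⟨t1, _, t2, _⟩ hj).2 ⟨d1, d2, h, rfl, rfl⟩
  have a2 := (mc_step A [false, true] ⟨s1', i, s2', j⟩ ⟨t1, _, t2, _⟩ hj).2 ⟨d1', d2', h', rfl, rfl⟩
  obtain ⟨_, _, b1, b2, -, -⟩ := (R.inverse _ _ _).2 a1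
  obtain ⟨_, _, c1, c2, -, -⟩ := (R.inverse _ _ _).2 a2
  simp only at b1 b2 c1 c2
  rw [b1] at c1
  rw [b2] at c2
  simp at c1 c2
  rw [c1.1, c2.1]

def up (w : List Bool) (i : ℕ) : List Sy := (Sum.inr false :: w.map Sum.inl).drop i
def lo (w : List Bool) (j : ℕ) : List Sy := ((w.map Sum.inl ++ [Sum.inr true]).take j).reverse

theorem up_head (w i) : (up w i).headD (Sum.inr true) = tape w i := by
  unfold up tape
  generalize (Sum.inr false :: w.map Sum.inl : List Sy) = l
  rw [List.headD_eq_head?_getD, List.head?_drop, List.getD_eq_getElem?_getD]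
  by_cases h : i < l.length
  · rw [List.getElem?_append_left h]
  · rw [List.getElem?_append_right (by omega), List.getElem?_eq_none (by omega)]
    rcases h : i - l.length with _ | n <;> simp

theorem lo_head (w j) (hj : j ≤ w.length + 1) : (lo w j).headD (Sum.inr false) = tape w j := by
  cases j with
  | zero => simp [lo, tape]
  | succ j =>
    have : j < (w.map (Sum.inl : Bool → Sy) ++ [Sum.inr true]).length := by simp; omega
    simp only [tape, List.cons_append, List.getD_cons_succ, lo]
    rw [List.getD_eq_getElem _ _ this, List.take_add_one, List.getElem?_eq_getElem this]
    rw [Option.toList_some, List.reverse_append, List.reverse_singleton, List.singleton_append, List.headD_cons]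

theorem up_mv (w i d) : mv d (up w i) = up w (i + cond d 1 0) := by
  cases d
  · rfl
  · simp [up]

theorem lo_mv (w j d) (hj : j ≤ w.length + 1) : mv d (lo w j) = lo w (j - cond d 1 0) := by
  cases d
  · rfl
  · cases j with
    | zero => simp [lo]
    | succ j =>
      have : j < (w.map (Sum.inl : Bool → Sy) ++ [Sum.inr true]).length := by simp; omega
      simp only [mv_true, lo, cond_true, Nat.add_sub_cancel]
      rw [List.take_add_one, List.getElem?_eq_getElem this]
      rw [Option.toList_some, List.reverse_append, List.reverse_singleton, List.singleton_append, List.tail_cons]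

theorem acc_of (A : DPWK Bool) (w : List Bool) (cs : List (Config A)) : ∀ c, c.j ≤ w.length + 1 →
    List.IsChain (Step A w) (c :: cs) → (∃ e, (c :: cs).getLast? = some e ∧ Halted A w e ∧ AccConf A e) →
    Acc (mc A) (c.p, c.q) (up w c.i) (lo w c.j) := by
  induction cs with
  | nil =>
    rintro c hj - ⟨e, he, h1, h2⟩
    simp at he
    subst he
    refine .halt ?_ h2
    rw [show (mc A).e1 = Sum.inr true from rfl, show (mc A).e2 = Sum.inr false from rfl, up_head, lo_head _ _ hj]
    rcases h : (mc A).G (tape w c.i) (tape w c.j) (c.p, c.q) with _ | ⟨⟨p, q⟩, d1, d2⟩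
    · rfl
    · exact (h1 ⟨⟨p, _, q, _⟩, (mc_step A w c _ hj).2 ⟨d1, d2, h, rfl, rfl⟩⟩).elim
  | cons c2 cs ih =>
    rintro c hj hc he
    rw [List.isChain_cons_cons] at hc
    obtain ⟨d1, d2, h1, h2, h3⟩ := (mc_step A w c c2 hj).1 hc.1
    refine .step (t := (c2.p, c2.q)) (d1 := d1) (d2 := d2) ?_ ?_
    · rw [show (mc A).e1 = Sum.inr true from rfl, show (mc A).e2 = Sum.inr false from rfl, up_head, lo_head _ _ hj]
      exact h1
    · rw [up_mv, lo_mv _ _ _ hj, ← h2, ← h3]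
      exact ih c2 (by omega) hc.2 (by simpa using he)

theorem of_acc (A : DPWK Bool) (w : List Bool) {s R1 R2} (h : Acc (mc A) s R1 R2) : ∀ c : Config A,
    c.j ≤ w.length + 1 → s = (c.p, c.q) → R1 = up w c.i → R2 = lo w c.j →
    ∃ cs, List.IsChain (Step A w) (c :: cs) ∧ ∃ e, (c :: cs).getLast? = some e ∧ Halted A w e ∧ AccConf A e := by
  induction h with
  | halt h1 h2 =>
    rintro c hj rfl rfl rfl
    rw [show (mc A).e1 = Sum.inr true from rfl, show (mc A).e2 = Sum.inr false from rfl, up_head, lo_head _ _ hj] at h1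
    refine ⟨[], by simp, c, by simp, ?_, h2⟩
    rintro ⟨c', hc'⟩
    obtain ⟨d1, d2, h3, -⟩ := (mc_step A w c c' hj).1 hc'
    rw [h1] at h3; cases h3
  | @step s R1 R2 t d1 d2 h1 _ ih =>
    rintro c hj rfl rfl rfl
    rw [show (mc A).e1 = Sum.inr true from rfl, show (mc A).e2 = Sum.inr false from rfl, up_head, lo_head _ _ hj] at h1
    obtain ⟨cs, h2, e, h3, h4⟩ := ih ⟨t.1, c.i + cond d1 1 0, t.2, c.j - cond d2 1 0⟩ (by simp only; omega) rfl
      (up_mv _ _ _) (lo_mv _ _ _ hj)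
    refine ⟨_ :: cs, List.isChain_cons_cons.2 ⟨(mc_step A w c _ hj).2 ⟨d1, d2, h1, rfl, rfl⟩, h2⟩, e, ?_, h4⟩
    simpa using h3

theorem accepts_iff (A : DPWK Bool) (w : List Bool) : Accepts A w ↔
    Acc (mc A) (mc A).s0 ((mc A).l :: w.map Sum.inl) ((mc A).r :: (w.map Sum.inl).reverse) := by
  have e1 : up w 0 = (mc A).l :: w.map Sum.inl := rfl
  have e2 : lo w (w.length + 1) = (mc A).r :: (w.map Sum.inl).reverse := by
    unfold lo
    rw [List.take_of_length_le (by simp)]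
    simp [mc]
  rw [← e1, ← e2]
  constructor
  · rintro ⟨cs, h1, h2, h3⟩
    cases cs with
    | nil => simp at h1
    | cons c cs =>
      simp at h1
      subst h1
      exact acc_of A w cs (initConf A w) le_rfl h2 h3
  · intro h
    obtain ⟨cs, h1, h2⟩ := of_acc A w h (initConf A w) le_rfl rfl rfl rfl
    exact ⟨initConf A w :: cs, rfl, h1, h2⟩

theorem isL_map {W : List Sy} (h : IsL W) : ∃ w : List Bool, W = w.map Sum.inl := by
  induction W with
  | nil => exact ⟨[], rfl⟩
  | cons z W ih =>
    obtain ⟨c, rfl⟩ := h z (by simp)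
    obtain ⟨w, rfl⟩ := ih (fun z hz => h z (by simp [hz]))
    exact ⟨c :: w, rfl⟩

theorem rec_QQ (A : DPWK Bool) (h : lang A = dfa.accepts) : Rec (mc A) QQ := by
  intro W hW
  obtain ⟨w, rfl⟩ := isL_map hW
  rw [← accepts_iff, QQ, fm_inl, ← h]
  exact Iff.rfl

end WKP

open WK in
/-- There exists a regular language (over `{a,b}`, modelled as
`Bool`) that is not accepted by any reversible deterministic two-party
Watson-Crick system. -/
theorem exists_regular_not_REV_PWK :
    ∃ L : Language Bool, L.IsRegular ∧
      ∀ A : DPWK Bool, Reversible A → lang A ≠ L := by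
  refine ⟨WKP.dfa.accepts, ⟨_, inferInstance, WKP.dfa, rfl⟩, fun A hA h => ?_⟩
  have := A.fQ1
  have := A.fQ2
  exact WKP.main_false (WKP.mc_inj A hA) (WKP.rec_QQ A h) WKP.tog_QQ
end
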